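/- arXiv:2602.10769 — 8 statements merged into one kernel-verified Lean document; each statement's English description precedes it below -/
import Mathlib

section
/- Define u : ℝ → ℤ by u(t) = 2k if t = kπ for some integer k, and u(t) = 2k+1 if kπ < t < (k+1)π for some integer k, and set u'(t) = u(t) + (2/π)t. Then: (i) u'(t + kπ) = u'(t) + 4k for all t ∈ ℝ and all k ∈ ℤ; and (ii) for all t₁, t₂ ∈ ℝ, sgn(sin t₁ · sin t₂ · sin(t₁+t₂)) = u'(t₁) + u'(t₂) − u'(t₁+t₂). -/
noncomputable section

theorem statement0 (u : ℝ → ℤ)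
    (hu_int : ∀ (t : ℝ) (k : ℤ), t = (k : ℝ) * Real.pi → u t = 2 * k)
    (hu_mid : ∀ (t : ℝ) (k : ℤ), (k : ℝ) * Real.pi < t → t < ((k : ℝ) + 1) * Real.pi →
      u t = 2 * k + 1) :
    (∀ (t : ℝ) (k : ℤ),
      (u (t + k * Real.pi) : ℝ) + 2 / Real.pi * (t + k * Real.pi) =
        ((u t : ℝ) + 2 / Real.pi * t) + 4 * k) ∧
    (∀ t₁ t₂ : ℝ,
      Real.sign (Real.sin t₁ * Real.sin t₂ * Real.sin (t₁ + t₂)) =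
        ((u t₁ : ℝ) + 2 / Real.pi * t₁) + ((u t₂ : ℝ) + 2 / Real.pi * t₂) -
          ((u (t₁ + t₂) : ℝ) + 2 / Real.pi * (t₁ + t₂))) := by
  have hpi := Real.pi_pos
  have dec : ∀ t : ℝ, ∃ (a : ℝ) (k : ℤ), 0 ≤ a ∧ a < Real.pi ∧ t = a + k * Real.pi := by
    intro t
    refine ⟨t - ⌊t / Real.pi⌋ * Real.pi, ⌊t / Real.pi⌋, ?_, ?_, by ring⟩
    · have := (le_div_iff₀ hpi).1 (Int.floor_le (t / Real.pi))
      linarith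
    · have := (div_lt_iff₀ hpi).1 (Int.lt_floor_add_one (t / Real.pi))
      linarith
  have hshift : ∀ (t : ℝ) (k : ℤ), u (t + k * Real.pi) = u t + 2 * k := by
    intro t k
    obtain ⟨a, m, h0, h1, rfl⟩ := dec t
    rcases h0.eq_or_lt with h | h
    · subst h
      rw [hu_int _ (m + k) (by push_cast; ring), hu_int _ m (by ring)]
      ring
    · rw [hu_mid _ (m + k) (by push_cast; linarith) (by push_cast; linarith),
        hu_mid _ m (by linarith) (by linarith)]
      ring
  have hbase : ∀ a b : ℝ, 0 ≤ a → a < Real.pi → 0 ≤ b → b < Real.pi →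
      Real.sign (Real.sin a * Real.sin b * Real.sin (a + b)) =
        (u a : ℝ) + u b - u (a + b) := by
    intro a b ha ha' hb hb'
    have u0 : u 0 = 0 := by simpa using hu_int 0 0 (by simp)
    rcases ha.eq_or_lt with h | h
    · subst h; simp [u0]
    rcases hb.eq_or_lt with h2 | h2
    · subst h2; simp [u0]
    have sa := Real.sin_pos_of_pos_of_lt_pi h ha'
    have sb := Real.sin_pos_of_pos_of_lt_pi h2 hb'
    have ua : u a = 1 := by simpa using hu_mid a 0 (by simpa using h) (by simpa using ha')
    have ub : u b = 1 := by simpa using hu_mid b 0 (by simpa using h2) (by simpa using hb')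
    rcases lt_trichotomy (a + b) Real.pi with h3 | h3 | h3
    · have sc := Real.sin_pos_of_pos_of_lt_pi (add_pos h h2) h3
      have uc : u (a + b) = 1 := by
        simpa using hu_mid (a + b) 0 (by simpa using add_pos h h2) (by simpa using h3)
      rw [Real.sign_of_pos (by positivity), ua, ub, uc]; norm_num
    · have uc : u (a + b) = 2 := by simpa using hu_int (a + b) 1 (by simpa using h3)
      rw [uc, ua, ub, h3]; norm_num
    · have sc : Real.sin (a + b) < 0 := by
        have := Real.sin_pos_of_pos_of_lt_pi (x := a + b - Real.pi) (by linarith) (by linarith)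
        rw [Real.sin_sub_pi] at this
        linarith
      have uc : u (a + b) = 3 := by
        simpa using hu_mid (a + b) 1 (by simpa using h3) (by push_cast; linarith)
      rw [Real.sign_of_neg (mul_neg_of_pos_of_neg (mul_pos sa sb) sc), ua, ub, uc]; norm_num
  constructor
  · intro t k
    rw [hshift]
    push_cast
    field_simp
    ring
  · intro t₁ t₂
    obtain ⟨a, m, ha, ha', rfl⟩ := dec t₁
    obtain ⟨b, n, hb, hb', rfl⟩ := dec t₂
    have e : a + m * Real.pi + (b + n * Real.pi) = (a + b) + ((m + n : ℤ) : ℝ) * Real.pi := by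
      push_cast; ring
    have hs : Real.sin (a + m * Real.pi) * Real.sin (b + n * Real.pi) *
        Real.sin ((a + b) + ((m + n : ℤ) : ℝ) * Real.pi) =
        Real.sin a * Real.sin b * Real.sin (a + b) := by
      rw [Real.sin_add_int_mul_pi, Real.sin_add_int_mul_pi, Real.sin_add_int_mul_pi,
        zpow_add₀ (by norm_num)]
      have hm : ((-1 : ℝ) ^ m) * (-1) ^ m = 1 := by rw [← mul_zpow]; simp
      have hn : ((-1 : ℝ) ^ n) * (-1) ^ n = 1 := by rw [← mul_zpow]; simp
      linear_combination (Real.sin a * Real.sin b * Real.sin (a + b)) *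
        (((-1 : ℝ) ^ n) * (-1) ^ n * hm + hn)
    rw [e, hs, hbase a b ha ha' hb hb', hshift, hshift, hshift]
    push_cast
    ring
end
end

section
/- For all g₁, g₂ ∈ SO₂(ℝ), c̄(g₁,g₂) = s̄(g₁)⁻¹ · s̄(g₂)⁻¹ · s̄(g₁g₂), where for the rotation matrix g = (cos t, −sin t; sin t, cos t) with t ∈ [−π, π) one sets s̄(g) := e^{it/2}. In particular, the restriction of Rao's sign cocycle c̄ to SO₂(ℝ) is a coboundary. -/
noncomputable section

/-- The real Hilbert symbol `(a,b)_ℝ`. -/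
def hilb (a b : ℝ) : ℝ := if a < 0 ∧ b < 0 then -1 else 1

def xEnt (g : Matrix (Fin 2) (Fin 2) ℝ) : ℝ := if g 1 0 = 0 then g 1 1 else g 1 0

/-- Rao's sign cocycle `c̄` on `SL₂(ℝ)`. -/
def raoC (g₁ g₂ : Matrix (Fin 2) (Fin 2) ℝ) : ℝ :=
  hilb (xEnt g₁) (xEnt g₂) * hilb (-(xEnt g₁ * xEnt g₂)) (xEnt (g₁ * g₂))

/-- The rotation matrix of angle `t`. -/
def rotM (t : ℝ) : Matrix (Fin 2) (Fin 2) ℝ :=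
  !![Real.cos t, -Real.sin t; Real.sin t, Real.cos t]

theorem xEnt_neg_aux (t : ℝ) (h : -Real.pi ≤ t ∧ t < Real.pi) (h0 : t < 0) : xEnt (rotM t) < 0 := by
  rcases eq_or_lt_of_le h.1 with h1 | h1
  · subst h1
    simp [xEnt, rotM]
  · have := Real.sin_neg_of_neg_of_neg_pi_lt h0 h1
    simp [xEnt, rotM, this.ne, this]

theorem xEnt_pos_aux (t : ℝ) (h : -Real.pi ≤ t ∧ t < Real.pi) (h0 : 0 ≤ t) : 0 < xEnt (rotM t) := by
  rcases eq_or_lt_of_le h0 with h1 | h1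
  · subst h1
    simp [xEnt, rotM]
  · have := Real.sin_pos_of_pos_of_lt_pi h1 h.2
    simp [xEnt, rotM, this.ne', this]

theorem statement1 (t₁ t₂ t₃ : ℝ)
    (h₁ : -Real.pi ≤ t₁ ∧ t₁ < Real.pi) (h₂ : -Real.pi ≤ t₂ ∧ t₂ < Real.pi)
    (h₃ : -Real.pi ≤ t₃ ∧ t₃ < Real.pi)
    (hmul : rotM t₁ * rotM t₂ = rotM t₃) :
    (raoC (rotM t₁) (rotM t₂) : ℂ) =
      (Complex.exp (Complex.I * (t₁ : ℂ) / 2))⁻¹ * (Complex.exp (Complex.I * (t₂ : ℂ) / 2))⁻¹ *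
        Complex.exp (Complex.I * (t₃ : ℂ) / 2) := by
  have hpi := Real.pi_pos
  have e1 : Real.cos (t₁ + t₂) = Real.cos t₃ := by
    have := congrFun (congrFun hmul 0) 0
    simp [rotM, Matrix.mul_apply, Fin.sum_univ_two] at this
    rw [Real.cos_add]; linarith
  have e2 : Real.sin (t₁ + t₂) = Real.sin t₃ := by
    have := congrFun (congrFun hmul 1) 0
    simp [rotM, Matrix.mul_apply, Fin.sum_univ_two] at this
    rw [Real.sin_add]; linarith
  have e3 : Real.cos (t₃ - (t₁ + t₂)) = 1 := by
    rw [Real.cos_sub, e1, e2]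
    nlinarith [Real.sin_sq_add_cos_sq t₃]
  obtain ⟨n, hn⟩ := (Real.cos_eq_one_iff _).1 e3
  have hR : (Complex.exp (Complex.I * (t₁ : ℂ) / 2))⁻¹ * (Complex.exp (Complex.I * (t₂ : ℂ) / 2))⁻¹ *
        Complex.exp (Complex.I * (t₃ : ℂ) / 2) = Complex.exp (n * (Real.pi * Complex.I)) := by
    rw [← Complex.exp_neg, ← Complex.exp_neg, ← Complex.exp_add, ← Complex.exp_add]
    congr 1
    have hc : (n : ℂ) * (2 * Real.pi) = t₃ - (t₁ + t₂) := by exact_mod_cast hn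
    linear_combination (-Complex.I / 2) * hc
  rw [hR, Complex.exp_int_mul, Complex.exp_pi_mul_I, raoC, hmul]
  have hn1 : n < 2 := by
    by_contra hc
    have : (2 : ℝ) ≤ n := by exact_mod_cast not_lt.1 hc
    nlinarith
  have hn2 : -2 < n := by
    by_contra hc
    have : (n : ℝ) ≤ -2 := by exact_mod_cast not_lt.1 hc
    nlinarith
  have key : ∀ t : ℝ, -Real.pi ≤ t ∧ t < Real.pi →
      (t < 0 ∧ xEnt (rotM t) < 0) ∨ (0 ≤ t ∧ 0 < xEnt (rotM t)) := fun t h => by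
    rcases lt_or_ge t 0 with h0 | h0
    · exact Or.inl ⟨h0, xEnt_neg_aux t h h0⟩
    · exact Or.inr ⟨h0, xEnt_pos_aux t h h0⟩
  have k1 := key t₁ h₁
  have k2 := key t₂ h₂
  have k3 := key t₃ h₃
  generalize xEnt (rotM t₁) = x at *
  generalize xEnt (rotM t₂) = y at *
  generalize xEnt (rotM t₃) = z at *
  rcases k1 with ⟨a1, b1⟩ | ⟨a1, b1⟩ <;> rcases k2 with ⟨a2, b2⟩ | ⟨a2, b2⟩ <;>
  rcases k3 with ⟨a3, b3⟩ | ⟨a3, b3⟩ <;>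
  interval_cases n <;> push_cast at hn <;>
  first
  | (exfalso; linarith [h₁.1, h₁.2, h₂.1, h₂.2, h₃.1, h₃.2])
  | (have := mul_pos_of_neg_of_neg b1 b2
     simp [hilb, b1, b2, b3, this, this.not_gt, b1.not_gt, b2.not_gt, b3.not_gt, b3.le])
  | (have := mul_pos b1 b2
     simp [hilb, b1, b2, b3, this, this.not_gt, b1.not_gt, b2.not_gt, b3.not_gt, b3.le])
  | (have := mul_neg_of_neg_of_pos b1 b2
     simp [hilb, b1, b2, b3, this, this.not_gt, b1.not_gt, b2.not_gt, b3.not_gt, b3.le])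
  | (have := mul_neg_of_pos_of_neg b1 b2
     simp [hilb, b1, b2, b3, this, this.not_gt, b1.not_gt, b2.not_gt, b3.not_gt, b3.le])
end
end

section
/- For all g₁, g₂ ∈ SL₂(ℝ), ĉ_{z₀}(g₁,g₂) = c̄(g₁,g₂) · s̄(g₁) · s̄(g₂) · s̄(g₁g₂)⁻¹. -/
noncomputable section

/-- The argument of a nonzero complex number, normalized to lie in `[-π, π)`. -/
def myArg (z : ℂ) : ℝ := if Complex.arg z = Real.pi then -Real.pi else Complex.arg z

/-- `s̄(g) := e^{i · Arg(ci+d)/2}`. -/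
def sbar (g : Matrix (Fin 2) (Fin 2) ℝ) : ℂ :=
  Complex.exp (Complex.I * (myArg ((g 1 0 : ℂ) * Complex.I + (g 1 1 : ℂ))) / 2)

/-- The Möbius action of a `2 × 2` real matrix on `ℂ`. -/
def mobius (g : Matrix (Fin 2) (Fin 2) ℝ) (z : ℂ) : ℂ :=
  ((g 0 0 : ℂ) * z + (g 0 1 : ℂ)) / ((g 1 0 : ℂ) * z + (g 1 1 : ℂ))

/-- `γ(z', z)` with the principal branch of the inverse square root. -/
def gammaK (z' z : ℂ) : ℂ :=
  ((z' - (starRingEnd ℂ) z) / (2 * Complex.I)) ^ (-(1 / 2) : ℂ) *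
    ((z'.im ^ ((1 : ℝ) / 4) : ℝ) : ℂ) * ((z.im ^ ((1 : ℝ) / 4) : ℝ) : ℂ)

/-- The cocycle `ĉ_{z₀}` with `z₀ = i`. -/
def chat (g₁ g₂ : Matrix (Fin 2) (Fin 2) ℝ) : ℂ :=
  gammaK (mobius g₁ Complex.I) (mobius (g₁ * g₂) Complex.I) /
    gammaK Complex.I (mobius g₂ Complex.I)


def pC (z : ℂ) : ℝ := if z.im = 0 then z.re else z.im

def sC (z : ℂ) : ℂ := Complex.exp (Complex.I * (myArg z) / 2)

lemma myArg_coe (z : ℂ) : (myArg z : Real.Angle) = (Complex.arg z : Real.Angle) := by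
  unfold myArg
  split_ifs with h
  · rw [h, Real.Angle.coe_neg]; simp
  · rfl

lemma myArg_ge (z : ℂ) : -Real.pi ≤ myArg z := by
  unfold myArg
  split_ifs with h
  · exact le_rfl
  · exact (Complex.neg_pi_lt_arg z).le

lemma myArg_lt (z : ℂ) : myArg z < Real.pi := by
  unfold myArg
  have := Real.pi_pos
  split_ifs with h
  · linarith
  · exact lt_of_le_of_ne (Complex.arg_le_pi z) h

lemma myArg_neg_iff (z : ℂ) : myArg z < 0 ↔ pC z < 0 := by
  unfold myArg pC
  have := Real.pi_pos
  by_cases h : z.arg = Real.pi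
  · rw [if_pos h]
    rw [Complex.arg_eq_pi_iff] at h
    rw [if_pos h.2]
    constructor
    · intro _; exact h.1
    · intro _; linarith
  · rw [if_neg h, Complex.arg_neg_iff]
    rw [Complex.arg_eq_pi_iff] at h
    split_ifs with h0
    · constructor
      · intro h1; linarith
      · intro h1; exact absurd ⟨h1, h0⟩ h
    · rfl

lemma pC_ne (z : ℂ) (hz : z ≠ 0) : pC z ≠ 0 := by
  unfold pC
  split_ifs with h
  · intro h1; exact hz (Complex.ext h1 h)
  · exact h

lemma sC_mul (z w : ℂ) (hz : z ≠ 0) (hw : w ≠ 0) (q : ℝ) (hq : q < 0 ↔ pC w < 0) (hq0 : q ≠ 0) :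
    ((hilb q (pC z) * hilb (-(q * pC z)) (pC (z * w)) : ℝ) : ℂ) * sC w * sC z = sC (z * w) := by
  have e : ((myArg z + myArg w : ℝ) : Real.Angle) = ((myArg (z * w) : ℝ) : Real.Angle) := by
    rw [Real.Angle.coe_add, myArg_coe, myArg_coe, myArg_coe, Complex.arg_mul_coe_angle hz hw]
  rw [Real.Angle.angle_eq_iff_two_pi_dvd_sub] at e
  obtain ⟨k, hk⟩ := e
  have hp := Real.pi_pos
  have z1 := myArg_ge z
  have z2 := myArg_lt z
  have w1 := myArg_ge w
  have w2 := myArg_lt w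
  have v1 := myArg_ge (z * w)
  have v2 := myArg_lt (z * w)
  have z3 := myArg_neg_iff z
  have w3 := myArg_neg_iff w
  have v3 := myArg_neg_iff (z * w)
  have z4 := pC_ne z hz
  have k1 : k < 2 := by
    have : (k : ℝ) < 2 := by nlinarith
    exact_mod_cast this
  have k2 : -2 < k := by
    have : (-2 : ℝ) < k := by nlinarith
    exact_mod_cast this
  rw [← hq] at w3
  have key : ∀ r : ℝ, (r = 1 ∧ k = 0) ∨ (r = -1 ∧ (k = 1 ∨ k = -1)) →
      (r : ℂ) * sC w * sC z = sC (z * w) := by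
    intro r hr
    have e1 : myArg (z * w) = myArg z + myArg w - 2 * Real.pi * k := by linarith
    unfold sC
    rw [e1, mul_assoc, ← Complex.exp_add]
    rcases hr with ⟨rfl, rfl⟩ | ⟨rfl, rfl | rfl⟩
    · push_cast
      rw [one_mul]
      congr 1
      ring
    · have : Complex.I * ((myArg z + myArg w - 2 * Real.pi * (1 : ℤ) : ℝ) : ℂ) / 2 =
        (Complex.I * (myArg w) / 2 + Complex.I * (myArg z) / 2) - Real.pi * Complex.I := by
        push_cast; ring
      rw [this, Complex.exp_sub, Complex.exp_pi_mul_I]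
      push_cast; ring
    · have : Complex.I * ((myArg z + myArg w - 2 * Real.pi * (-1 : ℤ) : ℝ) : ℂ) / 2 =
        (Complex.I * (myArg w) / 2 + Complex.I * (myArg z) / 2) + Real.pi * Complex.I := by
        push_cast; ring
      rw [this, Complex.exp_add _ (Real.pi * Complex.I), Complex.exp_pi_mul_I]
      push_cast; ring
  apply key
  have k3 : k = -1 ∨ k = 0 ∨ k = 1 := by omega
  have hh : -(q * pC z) < 0 ↔ (q < 0 ↔ pC z < 0) := by
    rw [neg_lt_zero, mul_pos_iff]
    constructor
    · rintro (⟨a, b⟩ | ⟨a, b⟩)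
      · constructor <;> intro <;> linarith
      · exact ⟨fun _ => b, fun _ => a⟩
    · intro h
      rcases lt_or_gt_of_ne hq0 with a | a
      · exact Or.inr ⟨a, h.1 a⟩
      · refine Or.inl ⟨a, lt_of_le_of_ne ?_ z4.symm⟩
        by_contra hc
        have := h.2 (not_le.1 hc)
        linarith
  unfold hilb
  simp only [hh, ← w3, ← z3, ← v3]
  clear key hh w3 z3 v3
  by_cases a : myArg w < 0 <;> by_cases b : myArg z < 0 <;> by_cases c : myArg (z * w) < 0 <;>
  rcases k3 with rfl | rfl | rfl <;> push_cast at hk <;> norm_num [a, b, c] <;> linarith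

lemma arg_abs_lt {P : ℂ} (hP : 0 < P.re) : |P.arg| < Real.pi / 2 :=
  Complex.abs_arg_lt_pi_div_two_iff.2 (Or.inl hP)

lemma arg_diff (P Q u v : ℂ) (r : ℝ) (hr : 0 < r) (hP : 0 < P.re) (hQ : 0 < Q.re)
    (hu : u ≠ 0) (hv : v ≠ 0) (h : P * v = r * (Q * u)) (hs : pC u < 0 ↔ pC v < 0) :
    P.arg - Q.arg = myArg u - myArg v := by
  have hP0 : P ≠ 0 := by rintro rfl; simp at hP
  have hQ0 : Q ≠ 0 := by rintro rfl; simp at hQ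
  have e : ((P.arg + myArg v : ℝ) : Real.Angle) = ((Q.arg + myArg u : ℝ) : Real.Angle) := by
    rw [Real.Angle.coe_add, Real.Angle.coe_add, myArg_coe, myArg_coe,
      ← Complex.arg_mul_coe_angle hP0 hv, ← Complex.arg_mul_coe_angle hQ0 hu, h,
      Complex.arg_real_mul _ hr]
  rw [Real.Angle.angle_eq_iff_two_pi_dvd_sub] at e
  obtain ⟨k, hk⟩ := e
  have hp := Real.pi_pos
  have z1 := myArg_ge u
  have z2 := myArg_lt u
  have w1 := myArg_ge v
  have w2 := myArg_lt v
  have hP1 := abs_lt.1 (arg_abs_lt hP)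
  have hQ1 := abs_lt.1 (arg_abs_lt hQ)
  rw [← myArg_neg_iff, ← myArg_neg_iff] at hs
  have hd : -Real.pi < myArg u - myArg v ∧ myArg u - myArg v < Real.pi := by
    by_cases a : myArg u < 0
    · have := hs.1 a
      constructor <;> linarith
    · have : ¬ myArg v < 0 := fun c => a (hs.2 c)
      constructor <;> linarith
  have k1 : k < 1 := by
    have : (k : ℝ) < 1 := by nlinarith
    exact_mod_cast this
  have k2 : -1 < k := by
    have : (-1 : ℝ) < k := by nlinarith
    exact_mod_cast this
  have k3 : k = 0 := by omega
  subst k3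
  push_cast at hk
  linarith

lemma cpow_half (P : ℂ) (hP : P ≠ 0) : P ^ (-(1 / 2) : ℂ) =
    ((‖P‖ ^ (-(1 / 2) : ℝ) : ℝ) : ℂ) * Complex.exp (-(Complex.I * P.arg / 2)) := by
  rw [Complex.cpow_def_of_ne_zero hP, Complex.log, Complex.ofReal_cpow (norm_nonneg _),
    Complex.cpow_def_of_ne_zero (by simpa using hP), ← Complex.exp_add,
    Complex.ofReal_log (norm_nonneg _)]
  congr 1
  push_cast
  ring

lemma gamma_ratio (P Q u v : ℂ) (y : ℝ) (hy : 0 < y) (hP : 0 < P.re) (hQ : 0 < Q.re)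
    (hu : u ≠ 0) (hv : v ≠ 0) (h : P = Q * (u * (starRingEnd ℂ) v)) (hs : pC u < 0 ↔ pC v < 0) :
    (Q ^ (-(1 / 2) : ℂ) * (((1 / ‖u‖ ^ 2) ^ ((1 : ℝ) / 4) : ℝ) : ℂ) *
      (((y / ‖v‖ ^ 2) ^ ((1 : ℝ) / 4) : ℝ) : ℂ)) /
      (P ^ (-(1 / 2) : ℂ) * (((1 : ℝ) ^ ((1 : ℝ) / 4) : ℝ) : ℂ) * ((y ^ ((1 : ℝ) / 4) : ℝ) : ℂ))
      * sC v = sC u := by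
  have hP0 : P ≠ 0 := by rintro rfl; simp at hP
  have hQ0 : Q ≠ 0 := by rintro rfl; simp at hQ
  have hu' := norm_pos_iff.2 hu
  have hv' := norm_pos_iff.2 hv
  have hQ' := norm_pos_iff.2 hQ0
  have hd := arg_diff P Q u v (‖v‖ ^ 2) (by positivity) hP hQ hu hv (by
    rw [h, mul_assoc, mul_assoc, mul_comm _ v, Complex.mul_conj, Complex.normSq_eq_norm_sq]
    ring) hs
  have hn : ‖P‖ = ‖Q‖ * (‖u‖ * ‖v‖) := by rw [h]; simp
  rw [cpow_half P hP0, cpow_half Q hQ0, hn]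
  have hq : ∀ t : ℝ, 0 < t → (1 / t ^ 2) ^ ((1 : ℝ) / 4) = t ^ (-(1 / 2) : ℝ) := by
    intro t ht
    rw [one_div, Real.inv_rpow (by positivity), ← Real.rpow_natCast, ← Real.rpow_mul ht.le,
      ← Real.rpow_neg ht.le]
    norm_num
  rw [hq _ hu', show y / ‖v‖ ^ 2 = y * (1 / ‖v‖ ^ 2) by ring,
    Real.mul_rpow hy.le (by positivity), hq _ hv', Real.mul_rpow hQ'.le (by positivity),
    Real.mul_rpow hu'.le hv'.le, Real.one_rpow]
  have e : sC u = Complex.exp (-(Complex.I * Q.arg / 2)) / Complex.exp (-(Complex.I * P.arg / 2)) *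
      sC v := by
    unfold sC
    rw [← Complex.exp_sub, ← Complex.exp_add]
    congr 1
    have : (P.arg : ℂ) - Q.arg = myArg u - myArg v := by exact_mod_cast hd
    linear_combination (-Complex.I / 2) * this
  rw [e]
  have a1 : ((‖Q‖ ^ (-(1 / 2) : ℝ) : ℝ) : ℂ) ≠ 0 := by
    exact_mod_cast (Real.rpow_pos_of_pos hQ' _).ne'
  have a2 : ((‖u‖ ^ (-(1 / 2) : ℝ) : ℝ) : ℂ) ≠ 0 := by
    exact_mod_cast (Real.rpow_pos_of_pos hu' _).ne'
  have a3 : ((‖v‖ ^ (-(1 / 2) : ℝ) : ℝ) : ℂ) ≠ 0 := by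
    exact_mod_cast (Real.rpow_pos_of_pos hv' _).ne'
  have a4 : ((y ^ ((1 : ℝ) / 4) : ℝ) : ℂ) ≠ 0 := by
    exact_mod_cast (Real.rpow_pos_of_pos hy _).ne'
  have a5 := Complex.exp_ne_zero (-(Complex.I * P.arg / 2))
  generalize ((‖Q‖ ^ (-(1 / 2) : ℝ) : ℝ)) = b1 at *
  generalize ((‖u‖ ^ (-(1 / 2) : ℝ) : ℝ)) = b2 at *
  generalize ((‖v‖ ^ (-(1 / 2) : ℝ) : ℝ)) = b3 at *
  generalize ((y ^ ((1 : ℝ) / 4) : ℝ)) = b4 at *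
  generalize Complex.exp (-(Complex.I * P.arg / 2)) = b5 at *
  push_cast
  field_simp

lemma den_ne (c d : ℝ) (h : ¬ (c = 0 ∧ d = 0)) (w : ℂ) (hw : 0 < w.im) : (c : ℂ) * w + d ≠ 0 := by
  intro h0
  have h1 := congrArg Complex.im h0
  have h2 := congrArg Complex.re h0
  simp at h1 h2
  rcases h1 with h1 | h1
  · subst h1; simp at h2; exact h ⟨rfl, h2⟩
  · linarith

lemma im_mob (a b c d : ℝ) (h : a * d - b * c = 1) (w : ℂ) :
    (((a : ℂ) * w + b) / ((c : ℂ) * w + d)).im = w.im / ‖(c : ℂ) * w + d‖ ^ 2 := by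
  rw [Complex.div_im, ← Complex.normSq_eq_norm_sq]
  simp
  rw [← sub_div]
  congr 1
  linear_combination w.im * h

lemma pC_den (c d : ℝ) (w : ℂ) (hw : 0 < w.im) :
    pC ((c : ℂ) * w + d) < 0 ↔ (if c = 0 then d else c) < 0 := by
  unfold pC
  by_cases hc : c = 0
  · simp [hc]
  · have : c * w.im ≠ 0 := mul_ne_zero hc hw.ne'
    simp [hc, hw.ne', mul_neg_iff, hw, hw.le, not_lt.2 hw.le]

lemma re_pos (z w : ℂ) (hz : 0 < z.im) (hw : 0 < w.im) :
    0 < ((z - (starRingEnd ℂ) w) / (2 * Complex.I)).re := by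
  have : ((z - (starRingEnd ℂ) w) / (2 * Complex.I)).re = (z.im + w.im) / 2 := by
    rw [Complex.div_re]; simp [Complex.normSq]; ring
  rw [this]; linarith

theorem statement2 (g₁ g₂ : Matrix (Fin 2) (Fin 2) ℝ) (h₁ : g₁.det = 1) (h₂ : g₂.det = 1) :
    chat g₁ g₂ = (raoC g₁ g₂ : ℂ) * sbar g₁ * sbar g₂ * (sbar (g₁ * g₂))⁻¹ := by
  have e1 := h₁
  have e2 := h₂
  rw [Matrix.det_fin_two] at e1 e2
  have hnc : ∀ a b c d : ℝ, a * d - b * c = 1 → ¬ (c = 0 ∧ d = 0) := by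
    rintro a b c d h ⟨rfl, rfl⟩; simp at h
  have n1 := hnc _ _ _ _ e1
  have n2 := hnc _ _ _ _ e2
  have hI : 0 < Complex.I.im := by simp
  set w := mobius g₂ Complex.I with hw
  set u := (g₁ 1 0 : ℂ) * Complex.I + g₁ 1 1 with hu
  set z := (g₂ 1 0 : ℂ) * Complex.I + g₂ 1 1 with hz
  have hu0 : u ≠ 0 := den_ne _ _ n1 _ hI
  have hz0 : z ≠ 0 := den_ne _ _ n2 _ hI
  have hwim : w.im = 1 / ‖z‖ ^ 2 := by
    have := im_mob _ _ _ _ e2 Complex.I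
    rwa [Complex.I_im] at this
  have hzn := norm_pos_iff.2 hz0
  have hun := norm_pos_iff.2 hu0
  have hwpos : 0 < w.im := by rw [hwim]; positivity
  set v := (g₁ 1 0 : ℂ) * w + g₁ 1 1 with hv
  have hv0 : v ≠ 0 := den_ne _ _ n1 _ hwpos
  have hvn := norm_pos_iff.2 hv0
  have hwz : w * z = (g₂ 0 0 : ℂ) * Complex.I + g₂ 0 1 := by
    rw [hw, mobius]; exact div_mul_cancel₀ _ hz0
  have hzv : ((g₁ * g₂) 1 0 : ℂ) * Complex.I + ((g₁ * g₂) 1 1 : ℂ) = z * v := by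
    simp only [Matrix.mul_apply, Fin.sum_univ_two]
    push_cast
    rw [hv]
    rw [hz] at hwz ⊢
    linear_combination (-(g₁ 1 0) : ℂ) * hwz
  have hm : mobius (g₁ * g₂) Complex.I = mobius g₁ w := by
    have hnum : ((g₁ * g₂) 0 0 : ℂ) * Complex.I + ((g₁ * g₂) 0 1 : ℂ) =
        z * ((g₁ 0 0 : ℂ) * w + g₁ 0 1) := by
      simp only [Matrix.mul_apply, Fin.sum_univ_two]
      push_cast
      rw [hz] at hwz ⊢
      linear_combination (-(g₁ 0 0) : ℂ) * hwz
    unfold mobius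
    rw [hnum, hzv]
    exact mul_div_mul_left _ _ hz0
  have i1 : (mobius g₁ Complex.I).im = 1 / ‖u‖ ^ 2 := by
    have := im_mob _ _ _ _ e1 Complex.I
    rwa [Complex.I_im] at this
  have i2 : (mobius g₁ w).im = w.im / ‖v‖ ^ 2 := im_mob _ _ _ _ e1 w
  have s1 := pC_den (g₁ 1 0) (g₁ 1 1) Complex.I hI
  have s2 := pC_den (g₁ 1 0) (g₁ 1 1) w hwpos
  have hcv0 : (starRingEnd ℂ) v ≠ 0 := by simpa using hv0
  have hPQ : (Complex.I - (starRingEnd ℂ) w) / (2 * Complex.I) =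
      (mobius g₁ Complex.I - (starRingEnd ℂ) (mobius g₁ w)) / (2 * Complex.I) *
        (u * (starRingEnd ℂ) v) := by
    have t1 : mobius g₁ Complex.I * u = (g₁ 0 0 : ℂ) * Complex.I + g₁ 0 1 :=
      div_mul_cancel₀ _ hu0
    have t2 : (starRingEnd ℂ) (mobius g₁ w) * (starRingEnd ℂ) v =
        (g₁ 0 0 : ℂ) * (starRingEnd ℂ) w + g₁ 0 1 := by
      rw [← map_mul, show mobius g₁ w * v = (g₁ 0 0 : ℂ) * w + g₁ 0 1 from
        div_mul_cancel₀ _ hv0]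
      simp
    have t3 : (starRingEnd ℂ) v = (g₁ 1 0 : ℂ) * (starRingEnd ℂ) w + g₁ 1 1 := by
      rw [hv]; simp
    have t4 : (g₁ 0 0 : ℂ) * g₁ 1 1 - g₁ 0 1 * g₁ 1 0 = 1 := by exact_mod_cast e1
    rw [div_mul_eq_mul_div]
    congr 1
    linear_combination (-(starRingEnd ℂ) v) * t1 + u * t2 -
      ((g₁ 0 0 : ℂ) * Complex.I + g₁ 0 1) * t3 +
      ((g₁ 0 0 : ℂ) * (starRingEnd ℂ) w + g₁ 0 1) * hu
      - (Complex.I - (starRingEnd ℂ) w) * t4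
  have main := gamma_ratio _ _ u v w.im hwpos (re_pos Complex.I w hI hwpos)
    (re_pos (mobius g₁ Complex.I) (mobius g₁ w) (by rw [i1]; positivity)
      (by rw [i2]; positivity)) hu0 hv0 hPQ (s1.trans s2.symm)
  have xz : xEnt g₂ = pC z := by
    unfold xEnt pC; simp [hz]
  have xzv : xEnt (g₁ * g₂) = pC (z * v) := by
    rw [← hzv]; unfold xEnt pC; simp
  have coc := sC_mul z v hz0 hv0 (xEnt g₁) s2.symm (by
    unfold xEnt
    split_ifs with h
    · exact fun h' => n1 ⟨h, h'⟩
    · exact h)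
  have hchat : chat g₁ g₂ * sC v = sC u := by
    rw [← main]
    unfold chat gammaK
    rw [hm, ← hw, i1, i2, Complex.I_im]
  have q1 : sbar g₁ = sC u := rfl
  have q2 : sbar g₂ = sC z := rfl
  have q3 : sbar (g₁ * g₂) = sC (z * v) := by rw [← hzv]; rfl
  have nz : ∀ t, sC t ≠ 0 := fun t => Complex.exp_ne_zero _
  rw [q1, q2, q3, ← hchat]
  have q4 : raoC g₁ g₂ = hilb (xEnt g₁) (pC z) * hilb (-(xEnt g₁ * pC z)) (pC (z * v)) := by
    rw [← xz, ← xzv]; rfl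
  rw [← q4] at coc
  rw [eq_mul_inv_iff_mul_eq₀ (nz _), ← coc]
  ring
end
end

section
/- For all g₁, g₂ ∈ SL₂(ℝ), ĉ_{z₀}(g₁,g₂) · ĉ_{z₀}(h₋₁g₁h₋₁, h₋₁g₂h₋₁) = 1, where h₋₁ = diag(1,−1) (so that h₋₁gh₋₁ ∈ SL₂(ℝ) for g ∈ SL₂(ℝ)). -/
noncomputable section

open Complex in
lemma denom_ne (c d : ℝ) (z : ℂ) (hz : 0 < z.im) (h : c ≠ 0 ∨ d ≠ 0) : (c : ℂ) * z + d ≠ 0 := by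
  intro h0
  have h1 := congrArg Complex.im h0
  have h2 := congrArg Complex.re h0
  simp at h1 h2
  rcases h1 with h1 | h1
  · subst h1; simp at h2; simp_all
  · linarith

lemma bot_ne (g : Matrix (Fin 2) (Fin 2) ℝ) (h : g.det = 1) : g 1 0 ≠ 0 ∨ g 1 1 ≠ 0 := by
  rw [Matrix.det_fin_two] at h
  by_contra! hc
  rw [hc.1, hc.2] at h
  simp at h

lemma mobius_sub (g : Matrix (Fin 2) (Fin 2) ℝ) (h : g.det = 1) (z w : ℂ)
    (hz : (g 1 0 : ℂ) * z + g 1 1 ≠ 0) (hw : (g 1 0 : ℂ) * w + g 1 1 ≠ 0) :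
    mobius g z - mobius g w = (z - w) / (((g 1 0 : ℂ) * z + g 1 1) * ((g 1 0 : ℂ) * w + g 1 1)) := by
  rw [Matrix.det_fin_two] at h
  have h' : (g 0 0 : ℂ) * g 1 1 - g 0 1 * g 1 0 = 1 := by exact_mod_cast h
  unfold mobius
  rw [div_sub_div _ _ hz hw]
  congr 1
  linear_combination (z - w) * h'

lemma mobius_conj (g : Matrix (Fin 2) (Fin 2) ℝ) (z : ℂ) :
    (starRingEnd ℂ) (mobius g z) = mobius g ((starRingEnd ℂ) z) := by
  simp [mobius]

lemma mobius_im (g : Matrix (Fin 2) (Fin 2) ℝ) (h : g.det = 1) (z : ℂ) (hz : 0 < z.im) :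
    (mobius g z).im = z.im / ‖(g 1 0 : ℂ) * z + g 1 1‖ ^ 2 := by
  have hd := denom_ne _ _ z hz (bot_ne g h)
  have hd' : (g 1 0 : ℂ) * (starRingEnd ℂ) z + g 1 1 ≠ 0 := by
    have := (map_ne_zero (starRingEnd ℂ)).2 hd
    simpa using this
  have h1 := mobius_sub g h z ((starRingEnd ℂ) z) hd hd'
  rw [← mobius_conj, Complex.sub_conj, Complex.sub_conj] at h1
  have h2 : ((g 1 0 : ℂ) * z + g 1 1) * ((g 1 0 : ℂ) * (starRingEnd ℂ) z + g 1 1)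
      = ((‖(g 1 0 : ℂ) * z + g 1 1‖ ^ 2 : ℝ) : ℂ) := by
    have := Complex.mul_conj' ((g 1 0 : ℂ) * z + g 1 1)
    simp only [map_add, map_mul, Complex.conj_ofReal] at this
    rw [this]; push_cast; rfl
  rw [h2] at h1
  have h3 := congrArg Complex.im h1
  rw [Complex.div_ofReal_im] at h3
  simp at h3
  rw [mul_div_assoc] at h3
  linarith

lemma mobius_im_pos (g : Matrix (Fin 2) (Fin 2) ℝ) (h : g.det = 1) (z : ℂ) (hz : 0 < z.im) :
    0 < (mobius g z).im := by
  rw [mobius_im g h z hz]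
  have hd := denom_ne _ _ z hz (bot_ne g h)
  positivity

lemma mobius_mul (g k : Matrix (Fin 2) (Fin 2) ℝ) (z : ℂ)
    (hz : (k 1 0 : ℂ) * z + k 1 1 ≠ 0) :
    mobius (g * k) z = mobius g (mobius k z) := by
  unfold mobius
  simp only [Matrix.mul_apply, Fin.sum_univ_two]
  push_cast
  rw [← mul_div_mul_right ((g 0 0 : ℂ) * (((k 0 0 : ℂ) * z + k 0 1) / ((k 1 0 : ℂ) * z + k 1 1)) + g 0 1) _ hz]
  congr 1 <;> field_simp <;> ring

lemma norm_gammaK (z' z : ℂ) (h' : 0 < z'.im) (h : 0 < z.im) :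
    ‖gammaK z' z‖ = (z'.im * z.im / (‖z' - (starRingEnd ℂ) z‖ / 2) ^ 2) ^ ((1 : ℝ) / 4) := by
  unfold gammaK
  have e : (-(1 / 2) : ℂ) = ((-(1 / 2) : ℝ) : ℂ) := by push_cast; rfl
  rw [norm_mul, norm_mul, e, Complex.norm_cpow_real, Complex.norm_real, Complex.norm_real,
    Real.norm_of_nonneg (by positivity), Real.norm_of_nonneg (by positivity),
    Real.div_rpow (by positivity) (by positivity), Real.mul_rpow h'.le h.le,
    ← Real.rpow_natCast, ← Real.rpow_mul (by positivity), norm_div, Real.rpow_neg (by positivity)]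
  simp
  norm_num
  field_simp

lemma norm_gammaK_inv (g : Matrix (Fin 2) (Fin 2) ℝ) (hg : g.det = 1) (z' z : ℂ)
    (h' : 0 < z'.im) (h : 0 < z.im) :
    ‖gammaK (mobius g z') (mobius g z)‖ = ‖gammaK z' z‖ := by
  rw [norm_gammaK _ _ (mobius_im_pos g hg _ h') (mobius_im_pos g hg _ h), norm_gammaK _ _ h' h]
  congr 1
  have hd' := denom_ne _ _ z' h' (bot_ne g hg)
  have hd := denom_ne _ _ z h (bot_ne g hg)
  have e : (g 1 0 : ℂ) * (starRingEnd ℂ) z + g 1 1 = (starRingEnd ℂ) ((g 1 0 : ℂ) * z + g 1 1) := by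
    simp
  have hc := (map_ne_zero (starRingEnd ℂ)).2 hd
  rw [mobius_conj, mobius_sub g hg _ _ hd' (by rwa [e]), mobius_im g hg _ h', mobius_im g hg _ h,
    norm_div, norm_mul, e, RCLike.norm_conj]
  have n1 := norm_ne_zero_iff.2 hd'
  have n2 := norm_ne_zero_iff.2 hd
  have n3 : ‖z' - (starRingEnd ℂ) z‖ ≠ 0 := by
    rw [norm_ne_zero_iff]
    intro h0
    have := congrArg Complex.im h0
    simp at this
    linarith
  field_simp

lemma gammaK_ne (z' z : ℂ) (h' : 0 < z'.im) (h : 0 < z.im) : ‖gammaK z' z‖ ≠ 0 := by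
  rw [norm_gammaK _ _ h' h]
  have n3 : ‖z' - (starRingEnd ℂ) z‖ ≠ 0 := by
    rw [norm_ne_zero_iff]
    intro h0
    have := congrArg Complex.im h0
    simp at this
    linarith
  positivity

lemma gammaK_conj (z' z : ℂ) (h' : 0 < z'.im) (h : 0 < z.im) :
    gammaK (-(starRingEnd ℂ) z') (-(starRingEnd ℂ) z) = (starRingEnd ℂ) (gammaK z' z) := by
  have harg : ((z' - (starRingEnd ℂ) z) / (2 * Complex.I)).arg ≠ Real.pi := by
    intro h0
    rw [Complex.arg_eq_pi_iff] at h0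
    have := h0.1
    have e : (z' - (starRingEnd ℂ) z) / (2 * Complex.I)
      = -((z' - (starRingEnd ℂ) z) * Complex.I) / ((2 : ℝ) : ℂ) := by
      rw [div_eq_div_iff (by simp) (by simp)]
      push_cast
      linear_combination 2 * (z' - (starRingEnd ℂ) z) * Complex.I_mul_I
    rw [e, Complex.div_ofReal_re] at this
    simp at this
    linarith
  have h2c : (starRingEnd ℂ) 2 = 2 := Complex.conj_ofNat 2
  unfold gammaK
  rw [map_mul, map_mul, Complex.conj_ofReal, Complex.conj_ofReal]
  have e := Complex.cpow_conj ((z' - (starRingEnd ℂ) z) / (2 * Complex.I)) (-(1 / 2) : ℂ) harg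
  have e2 : (starRingEnd ℂ) (-(1 / 2) : ℂ) = (-(1 / 2) : ℂ) := by simp [h2c]
  rw [e2] at e
  rw [e]
  have e4 : (-(starRingEnd ℂ) z' - (starRingEnd ℂ) (-(starRingEnd ℂ) z)) / (2 * Complex.I) =
    (starRingEnd ℂ) ((z' - (starRingEnd ℂ) z) / (2 * Complex.I)) := by
    simp [h2c]
    ring
  rw [e4]
  simp only [Complex.conj_conj, Complex.neg_im, Complex.conj_im, neg_neg]

lemma mobius_h (g : Matrix (Fin 2) (Fin 2) ℝ) :
    mobius (!![(1 : ℝ), 0; 0, -1] * g * !![(1 : ℝ), 0; 0, -1]) Complex.I =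
      -(starRingEnd ℂ) (mobius g Complex.I) := by
  simp [mobius, Matrix.mul_apply, Fin.sum_univ_two, Matrix.vecMul, dotProduct]
  rw [← neg_div]
  congr 1
  ring

theorem statement3 (g₁ g₂ : Matrix (Fin 2) (Fin 2) ℝ) (h₁ : g₁.det = 1) (h₂ : g₂.det = 1) :
    chat g₁ g₂ *
      chat (!![(1 : ℝ), 0; 0, -1] * g₁ * !![(1 : ℝ), 0; 0, -1])
        (!![(1 : ℝ), 0; 0, -1] * g₂ * !![(1 : ℝ), 0; 0, -1]) = 1 := by
  have hI : 0 < Complex.I.im := by simp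
  have h12 : (g₁ * g₂).det = 1 := by rw [Matrix.det_mul, h₁, h₂, one_mul]
  have hh : (!![(1 : ℝ), 0; 0, -1]) * (!![(1 : ℝ), 0; 0, -1]) = 1 := by
    ext i j; fin_cases i <;> fin_cases j <;> simp
  have hm : (!![(1 : ℝ), 0; 0, -1] * g₁ * !![(1 : ℝ), 0; 0, -1]) *
      (!![(1 : ℝ), 0; 0, -1] * g₂ * !![(1 : ℝ), 0; 0, -1]) =
      !![(1 : ℝ), 0; 0, -1] * (g₁ * g₂) * !![(1 : ℝ), 0; 0, -1] := by
    generalize !![(1 : ℝ), 0; 0, -1] = H at *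
    calc _ = H * g₁ * (H * H) * g₂ * H := by simp only [mul_assoc]
      _ = _ := by rw [hh]; simp only [mul_assoc, mul_one]
  have key : chat (!![(1 : ℝ), 0; 0, -1] * g₁ * !![(1 : ℝ), 0; 0, -1])
        (!![(1 : ℝ), 0; 0, -1] * g₂ * !![(1 : ℝ), 0; 0, -1]) = (starRingEnd ℂ) (chat g₁ g₂) := by
    unfold chat
    rw [hm, mobius_h, mobius_h, mobius_h, gammaK_conj _ _ (mobius_im_pos _ h₁ _ hI)
      (mobius_im_pos _ h12 _ hI), map_div₀, ← gammaK_conj Complex.I _ hI (mobius_im_pos _ h₂ _ hI)]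
    simp
  have hn : ‖chat g₁ g₂‖ = 1 := by
    unfold chat
    rw [mobius_mul _ _ _ (denom_ne _ _ _ hI (bot_ne _ h₂)), norm_div,
      norm_gammaK_inv _ h₁ _ _ hI (mobius_im_pos _ h₂ _ hI)]
    exact div_self (gammaK_ne _ _ hI (mobius_im_pos _ h₂ _ hI))
  rw [key, Complex.mul_conj', hn]
  simp
end
end

section
/- For every y ∈ ℝ∖{0} and all g₁, g₂ ∈ SL₂(ℝ), c̄(g₁,g₂) = c̄(g₁^y, g₂^y) · ν₂(y,g₁) · ν₂(y,g₂) · ν₂(y,g₁g₂)⁻¹. In other words, conjugation by diag(1,y) changes Rao's sign cocycle by the explicit coboundary determined by ν₂(y,·). -/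
noncomputable section

def nu2 (y : ℝ) (g : Matrix (Fin 2) (Fin 2) ℝ) : ℝ := if g 1 0 = 0 then hilb y (g 0 0) else 1

/-- `g^y := diag(1,y)⁻¹ · g · diag(1,y)`. -/
def conjY (y : ℝ) (g : Matrix (Fin 2) (Fin 2) ℝ) : Matrix (Fin 2) (Fin 2) ℝ :=
  (!![(1 : ℝ), 0; 0, y])⁻¹ * g * !![(1 : ℝ), 0; 0, y]

theorem conjY_eq (y : ℝ) (hy : y ≠ 0) (g : Matrix (Fin 2) (Fin 2) ℝ) :
    conjY y g = !![g 0 0, g 0 1 * y; y⁻¹ * g 1 0, g 1 1] := by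
  have : (!![(1 : ℝ), 0; 0, y])⁻¹ = !![(1 : ℝ), 0; 0, y⁻¹] := by
    apply Matrix.inv_eq_left_inv
    ext i j
    fin_cases i <;> fin_cases j <;> simp [hy]
  rw [conjY, this]
  have e : g = !![g 0 0, g 0 1; g 1 0, g 1 1] := Matrix.eta_fin_two g
  generalize g 0 0 = a, g 0 1 = b, g 1 0 = c, g 1 1 = d at *
  subst e
  rw [Matrix.mul_fin_two, Matrix.mul_fin_two]
  congr 1; simp
  rw [mul_right_comm, inv_mul_cancel₀ hy, one_mul]

theorem conjY_mul (y : ℝ) (hy : y ≠ 0) (g h : Matrix (Fin 2) (Fin 2) ℝ) :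
    conjY y g * conjY y h = conjY y (g * h) := by
  rw [conjY_eq y hy, conjY_eq y hy, conjY_eq y hy]
  ext i j
  fin_cases i <;> fin_cases j <;> simp [Matrix.mul_apply, Fin.sum_univ_two] <;> field_simp

theorem hilb_comm (a b : ℝ) : hilb a b = hilb b a := by simp [hilb, and_comm]

theorem hilb_mul (a b c : ℝ) (ha : a ≠ 0) (hb : b ≠ 0) :
    hilb (a * b) c = hilb a c * hilb b c := by
  rcases lt_or_gt_of_ne ha with h | h <;> rcases lt_or_gt_of_ne hb with h' | h' <;>
  by_cases hc : c < 0 <;>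
  simp [hilb, hc, h, h', h.le, h'.le, h.not_gt, h'.not_gt, mul_neg_iff]

theorem hilb_mul' (a b c : ℝ) (ha : a ≠ 0) (hb : b ≠ 0) :
    hilb c (a * b) = hilb c a * hilb c b := by
  rw [hilb_comm, hilb_mul _ _ _ ha hb, hilb_comm a, hilb_comm b]

theorem hilb_sq (a b : ℝ) : hilb a b * hilb a b = 1 := by
  unfold hilb; split_ifs <;> norm_num

theorem hilb_inv (a b : ℝ) : (hilb a b)⁻¹ = hilb a b := by
  unfold hilb; split_ifs <;> norm_num

theorem hilb_yinv (y b : ℝ) : hilb y⁻¹ b = hilb y b := by simp [hilb]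

theorem key (y a b c : ℝ) (hy : y ≠ 0) (ha : a ≠ 0) (hb : b ≠ 0) (hc : c ≠ 0)
    (A B C u v w : ℝ)
    (h : (A = y⁻¹ * a ∧ B = y⁻¹ * b ∧ C = y⁻¹ * c ∧ u * v * w = 1) ∨
      (A = y⁻¹ * a ∧ B = y⁻¹ * b ∧ C = c ∧ u * v * w = hilb y (-(a * b))
        ∧ hilb y c = hilb y (-(a * b)))
      ∨ (A = a ∧ B = y⁻¹ * b ∧ C = y⁻¹ * c ∧ u * v * w = hilb y a ∧ 0 < a * b * c)
      ∨ (A = y⁻¹ * a ∧ B = b ∧ C = y⁻¹ * c ∧ u * v * w = hilb y b ∧ 0 < a * b * c)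
      ∨ (A = a ∧ B = b ∧ C = c ∧ u * v * w = 1)) :
    hilb a b * hilb (-(a * b)) c = hilb A B * hilb (-(A * B)) C * u * v * w := by
  have e : hilb A B * hilb (-(A * B)) C * u * v * w
    = hilb A B * hilb (-(A * B)) C * (u * v * w) := by ring
  rw [e]
  have hyi := inv_ne_zero hy
  rcases lt_or_gt_of_ne hy with h0 | h0 <;> rcases lt_or_gt_of_ne ha with h1 | h1 <;>
  rcases lt_or_gt_of_ne hb with h2 | h2 <;> rcases lt_or_gt_of_ne hc with h3 | h3 <;>
  rcases h with ⟨rfl, rfl, rfl, h⟩ | ⟨rfl, rfl, rfl, h, h'⟩ | ⟨rfl, rfl, rfl, h, h'⟩ |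
    ⟨rfl, rfl, rfl, h, h'⟩ | ⟨rfl, rfl, rfl, h⟩ <;> rw [h] <;>
  (try simp [hilb, mul_neg_iff, mul_pos_iff, h0, h1, h2, h3, h0.not_gt, h1.not_gt, h2.not_gt,
    h3.not_gt] at h') <;>
  (try simp [hilb, mul_neg_iff, mul_pos_iff, h0, h1, h2, h3, h0.not_gt, h1.not_gt, h2.not_gt,
    h3.not_gt])

theorem statement6 (y : ℝ) (hy : y ≠ 0) (g₁ g₂ : Matrix (Fin 2) (Fin 2) ℝ)
    (h₁ : g₁.det = 1) (h₂ : g₂.det = 1) :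
    raoC g₁ g₂ =
      raoC (conjY y g₁) (conjY y g₂) * nu2 y g₁ * nu2 y g₂ * (nu2 y (g₁ * g₂))⁻¹ := by
  have h₃ : (g₁ * g₂).det = 1 := by rw [Matrix.det_mul, h₁, h₂, one_mul]
  have e3 : (g₁ * g₂) 1 0 = g₁ 1 0 * g₂ 0 0 + g₁ 1 1 * g₂ 1 0 := by
    simp [Matrix.mul_apply, Fin.sum_univ_two]
  have e4 : (g₁ * g₂) 0 0 = g₁ 0 0 * g₂ 0 0 + g₁ 0 1 * g₂ 1 0 := by
    simp [Matrix.mul_apply, Fin.sum_univ_two]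
  have e5 : (g₁ * g₂) 1 1 = g₁ 1 0 * g₂ 0 1 + g₁ 1 1 * g₂ 1 1 := by
    simp [Matrix.mul_apply, Fin.sum_univ_two]
  have xne : ∀ g : Matrix (Fin 2) (Fin 2) ℝ, g.det = 1 → xEnt g ≠ 0 := by
    intro g hg
    rw [Matrix.det_fin_two] at hg
    unfold xEnt
    split_ifs with h
    · intro h'; rw [h, h'] at hg; simp at hg
    · exact h
  have xc : ∀ g : Matrix (Fin 2) (Fin 2) ℝ, xEnt (conjY y g) =
      if g 1 0 = 0 then g 1 1 else y⁻¹ * g 1 0 := by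
    intro g
    rw [conjY_eq y hy]
    simp [xEnt, hy]
  have diag : ∀ g : Matrix (Fin 2) (Fin 2) ℝ, g.det = 1 → g 1 0 = 0 →
      hilb y (g 0 0) = hilb y (g 1 1) := by
    intro g hg h0
    rw [Matrix.det_fin_two, h0] at hg
    have : 0 < g 0 0 * g 1 1 := by linarith
    rcases mul_pos_iff.1 this with ⟨p, q⟩ | ⟨p, q⟩ <;> simp [hilb, p, q, p.not_gt, q.not_gt]
  unfold raoC
  rw [conjY_mul y hy]
  refine key y _ _ _ hy (xne _ h₁) (xne _ h₂) (xne _ h₃) _ _ _ _ _ _ ?_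
  have d1 := diag _ h₁
  have d2 := diag _ h₂
  have d3 := diag _ h₃
  rw [xc, xc, xc]
  have n1 := xne _ h₁
  have n2 := xne _ h₂
  rw [Matrix.det_fin_two] at h₁ h₂
  unfold xEnt nu2 at *
  by_cases c1 : g₁ 1 0 = 0 <;> by_cases c2 : g₂ 1 0 = 0
  · have c3 : (g₁ * g₂) 1 0 = 0 := by rw [e3, c1, c2]; ring
    have m : (g₁ * g₂) 1 1 = g₁ 1 1 * g₂ 1 1 := by rw [e5, c1]; ring
    simp only [c1, c2, if_true] at n1 n2
    refine Or.inr (Or.inr (Or.inr (Or.inr ?_)))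
    simp only [c1, c2, c3, if_true, true_and]
    rw [d1 c1, d2 c2, d3 c3, m, hilb_mul' _ _ _ n1 n2, mul_inv_cancel₀]
    intro h
    have s1 := hilb_sq y (g₁ 1 1)
    have s2 := hilb_sq y (g₂ 1 1)
    rcases mul_eq_zero.1 h with h | h <;> simp [h] at s1 s2
  · simp only [c1, c2, if_true, if_false] at n1 n2
    have m : (g₁ * g₂) 1 0 = g₁ 1 1 * g₂ 1 0 := by rw [e3, c1]; ring
    have c3 : (g₁ * g₂) 1 0 ≠ 0 := by rw [m]; exact mul_ne_zero n1 n2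
    refine Or.inr (Or.inr (Or.inl ?_))
    simp only [c1, c2, c3, if_true, if_false, true_and]
    refine ⟨by rw [d1 c1]; simp, ?_⟩
    rw [m]; exact mul_self_pos.2 (mul_ne_zero n1 n2)
  · simp only [c1, c2, if_true, if_false] at n1 n2
    have m : (g₁ * g₂) 1 0 = g₁ 1 0 * g₂ 0 0 := by rw [e3, c2]; ring
    have k : g₂ 0 0 * g₂ 1 1 = 1 := by rw [c2] at h₂; linarith
    have c3 : (g₁ * g₂) 1 0 ≠ 0 := by rw [m]; exact mul_ne_zero n1 (left_ne_zero_of_mul_eq_one k)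
    refine Or.inr (Or.inr (Or.inr (Or.inl ?_)))
    simp only [c1, c2, c3, if_true, if_false, true_and]
    refine ⟨by rw [d2 c2]; simp, ?_⟩
    rw [m]
    have : g₁ 1 0 * g₂ 1 1 * (g₁ 1 0 * g₂ 0 0) = g₁ 1 0 ^ 2 := by linear_combination g₁ 1 0 ^ 2 * k
    rw [this]; positivity
  · by_cases c3 : (g₁ * g₂) 1 0 = 0
    · refine Or.inr (Or.inl ?_)
      simp only [c1, c2, c3, if_true, if_false, true_and]
      have m : g₂ 1 0 = - (g₁ 1 0 * (g₁ * g₂) 0 0) := by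
        rw [e4]; rw [e3] at c3
        linear_combination (-g₂ 1 0) * h₁ + g₁ 0 0 * c3
      have q : hilb y ((g₁ * g₂) 0 0) = hilb y (-(g₁ 1 0 * g₂ 1 0)) := by
        have : -(g₁ 1 0 * g₂ 1 0) = g₁ 1 0 ^ 2 * (g₁ * g₂) 0 0 := by
          linear_combination (-g₁ 1 0) * m
        have p : 0 < g₁ 1 0 ^ 2 := by positivity
        rw [this]
        simp [hilb, mul_neg_iff, p, p.not_gt]
      rw [← d3 c3, q, hilb_inv]
      simp
    · left
      simp [c1, c2, c3]
end
end

section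
/- Let Γ^±(2) := {h ∈ M₂(ℤ) : det h = ±1 and h ≡ I (mod 2)}, a subgroup of GL₂(ℝ). There is no function f : Γ^±(2) → ℂ∖{0} such that C̄(h₁,h₂) = f(h₁)·f(h₂)·f(h₁h₂)⁻¹ for all h₁, h₂ ∈ Γ^±(2). In particular no such trivializing function exists on SL₂^±(ℤ) := {h ∈ M₂(ℤ) : det h = ±1}, i.e., the restriction of the 2-cocycle C̄ to SL₂^±(ℤ) is not a coboundary. -/
noncomputable section

/-- The `SL₂`-part `g_h` in the factorization `h = diag(1, det h) · g_h`. -/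
def slPart (h : Matrix (Fin 2) (Fin 2) ℝ) : Matrix (Fin 2) (Fin 2) ℝ :=
  !![h 0 0, h 0 1; h 1 0 / h.det, h 1 1 / h.det]

/-- The extended cocycle `C̄` on `GL₂(ℝ)`. -/
def CbarGL (h₁ h₂ : Matrix (Fin 2) (Fin 2) ℝ) : ℝ :=
  nu2 h₂.det (slPart h₁) * raoC (conjY h₂.det (slPart h₁)) (slPart h₂)

def toR (g : Matrix (Fin 2) (Fin 2) ℤ) : Matrix (Fin 2) (Fin 2) ℝ := g.map fun x => (x : ℝ)

/-- `SL₂^±(ℤ)`: integer matrices of determinant `±1`. -/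
def SLpmZ : Set (Matrix (Fin 2) (Fin 2) ℤ) := {h | h.det = 1 ∨ h.det = -1}

/-- `Γ^±(2)`: integer matrices of determinant `±1` congruent to `I` modulo `2`. -/
def GammaPM2 : Set (Matrix (Fin 2) (Fin 2) ℤ) :=
  {h | (h.det = 1 ∨ h.det = -1) ∧ Odd (h 0 0) ∧ Even (h 0 1) ∧ Even (h 1 0) ∧ Odd (h 1 1)}

lemma c1 : CbarGL (toR !![-1,0;0,-1]) (toR !![1,0;0,-1]) = -1 := by
  have e : (!![(1 : ℝ), 0; 0, -1])⁻¹ = !![(1 : ℝ), 0; 0, -1] := by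
    apply Matrix.inv_eq_left_inv
    ext i j; fin_cases i <;> fin_cases j <;> simp [Matrix.mul_apply]
  norm_num [CbarGL, toR, nu2, raoC, conjY, slPart, xEnt, hilb, Matrix.det_fin_two, e,
    Matrix.mul_apply]

lemma c2 : CbarGL (toR !![1,0;0,-1]) (toR !![-1,0;0,-1]) = 1 := by
  have e : (!![(1 : ℝ), 0; 0, 1])⁻¹ = !![(1 : ℝ), 0; 0, 1] := by
    apply Matrix.inv_eq_left_inv
    ext i j; fin_cases i <;> fin_cases j <;> simp [Matrix.mul_apply]
  norm_num [CbarGL, toR, nu2, raoC, conjY, slPart, xEnt, hilb, Matrix.det_fin_two, e,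
    Matrix.mul_apply]

lemma key_s7 (S : Set (Matrix (Fin 2) (Fin 2) ℤ)) (hS : GammaPM2 ⊆ S) :
    ¬ ∃ f : Matrix (Fin 2) (Fin 2) ℤ → ℂ,
      (∀ h ∈ S, f h ≠ 0) ∧
        ∀ h₁ ∈ S, ∀ h₂ ∈ S,
          (CbarGL (toR h₁) (toR h₂) : ℂ) = f h₁ * f h₂ * (f (h₁ * h₂))⁻¹ := by
  rintro ⟨f, -, hf⟩
  have hA : !![-1,0;0,-1] ∈ S := hS (by
    refine ⟨?_, ?_, ?_, ?_, ?_⟩ <;> simp [Matrix.det_fin_two])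
  have hB : !![1,0;0,-1] ∈ S := hS (by
    refine ⟨?_, ?_, ?_, ?_, ?_⟩ <;> simp [Matrix.det_fin_two])
  have h1 := hf _ hA _ hB
  have h2 := hf _ hB _ hA
  have hc : (!![-1,0;0,-1] * !![1,0;0,-1] : Matrix (Fin 2) (Fin 2) ℤ)
      = !![1,0;0,-1] * !![-1,0;0,-1] := by decide
  rw [c1, hc, mul_comm (f _) (f _), ← h2, c2] at h1
  norm_num at h1

theorem statement7 :
    (¬ ∃ f : Matrix (Fin 2) (Fin 2) ℤ → ℂ,
      (∀ h ∈ GammaPM2, f h ≠ 0) ∧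
        ∀ h₁ ∈ GammaPM2, ∀ h₂ ∈ GammaPM2,
          (CbarGL (toR h₁) (toR h₂) : ℂ) = f h₁ * f h₂ * (f (h₁ * h₂))⁻¹) ∧
    (¬ ∃ f : Matrix (Fin 2) (Fin 2) ℤ → ℂ,
      (∀ h ∈ SLpmZ, f h ≠ 0) ∧
        ∀ h₁ ∈ SLpmZ, ∀ h₂ ∈ SLpmZ,
          (CbarGL (toR h₁) (toR h₂) : ℂ) = f h₁ * f h₂ * (f (h₁ * h₂))⁻¹) := by
  exact ⟨key_s7 _ subset_rfl, key_s7 _ fun _ h => h.1⟩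
end
end

section
/- Let g₁, g₂ ∈ SL₂(ℤ), let c₁, c₂ be their lower-left entries, and let c₃ be the lower-left entry of g₁g₂. Then: (i) e^{(iπ/4)·sgn(c₁c₂c₃)} = β̃₁(g₁)⁻¹ · β̃₁(g₂)⁻¹ · β̃₁(g₁g₂), where β̃₁(g) := e^{−πi·μ(g)}·m(g); and (ii) ĉ_{z₀}(g₁,g₂) = β̂₁(g₁)⁻¹ · β̂₁(g₂)⁻¹ · β̂₁(g₁g₂), where β̂₁(g) := e^{−πi·μ(g)}·s̄(g)⁻¹. -/
noncomputable section

/-- The function `m(g)` on `SL₂(ℝ)`. -/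
def mX (g : Matrix (Fin 2) (Fin 2) ℝ) : ℂ :=
  if g 1 0 = 0 then
    Complex.exp (Complex.I * (Real.pi : ℂ) / 4 * ((1 : ℂ) - (Real.sign (g 1 1) : ℂ)))
  else Complex.exp (-(Complex.I * (Real.pi : ℂ) / 4) * (Real.sign (g 1 0) : ℂ))

open scoped Classical in
/-- The sawtooth function `((x))`. -/
def saw (x : ℝ) : ℝ := if ∃ n : ℤ, x = (n : ℝ) then 0 else x - (⌊x⌋ : ℝ) - 1 / 2

/-- The Dedekind sum `s(d, c)`. -/
def dedekindSum (d c : ℤ) : ℝ :=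
  ∑ k ∈ Finset.Icc 1 c.natAbs, saw ((k : ℝ) / (c : ℝ)) * saw ((k : ℝ) * (d : ℝ) / (c : ℝ))

/-- Asai's function `μ` on `SL₂(ℤ)`. -/
def asai (g : Matrix (Fin 2) (Fin 2) ℤ) : ℝ :=
  if g 1 0 = 0 then (g 0 1 : ℝ) / (12 * (g 1 1 : ℝ)) + (1 - (Int.sign (g 1 1) : ℝ)) / 4
  else ((g 0 0 : ℝ) + (g 1 1 : ℝ)) / (12 * (g 1 0 : ℝ)) -
    (Int.sign (g 1 0) : ℝ) * (1 / 4 + dedekindSum (g 1 1) (((g 1 0).natAbs : ℤ)))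

/-- `β̃₁(g) := e^{-πi·μ(g)} · m(g)`. -/
def btilde1 (g : Matrix (Fin 2) (Fin 2) ℤ) : ℂ :=
  Complex.exp (-(Real.pi : ℂ) * Complex.I * (asai g : ℂ)) * mX (toR g)

/-- `β̂₁(g) := e^{-πi·μ(g)} · s̄(g)⁻¹`. -/
def bhat1 (g : Matrix (Fin 2) (Fin 2) ℤ) : ℂ :=
  Complex.exp (-(Real.pi : ℂ) * Complex.I * (asai g : ℂ)) * (sbar (toR g))⁻¹


lemma saw_add_int (x : ℝ) (n : ℤ) : saw (x + n) = saw x := by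
  unfold saw
  have h : (∃ m : ℤ, x + n = (m : ℝ)) ↔ ∃ m : ℤ, x = (m : ℝ) := by
    constructor
    · rintro ⟨m, hm⟩
      exact ⟨m - n, by push_cast; linarith⟩
    · rintro ⟨m, hm⟩
      exact ⟨m + n, by push_cast; linarith⟩
  by_cases hx : ∃ m : ℤ, x = (m : ℝ)
  · rw [if_pos hx, if_pos (h.2 hx)]
  · rw [if_neg hx, if_neg (fun h' => hx (h.1 h')), Int.floor_add_intCast]
    push_cast; ring

lemma saw_neg (x : ℝ) : saw (-x) = -saw x := by
  unfold saw
  have h : (∃ m : ℤ, -x = (m : ℝ)) ↔ ∃ m : ℤ, x = (m : ℝ) := by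
    constructor
    · rintro ⟨m, hm⟩
      exact ⟨-m, by push_cast; linarith⟩
    · rintro ⟨m, hm⟩
      exact ⟨-m, by push_cast; linarith⟩
  by_cases hx : ∃ m : ℤ, x = (m : ℝ)
  · rw [if_pos hx, if_pos (h.2 hx)]; simp
  · rw [if_neg hx, if_neg (fun h' => hx (h.1 h'))]
    have : ⌊-x⌋ = -⌊x⌋ - 1 := by
      rw [Int.floor_eq_iff]
      have h1 := Int.floor_le x
      have h2 := Int.lt_floor_add_one x
      have h3 : (⌊x⌋ : ℝ) ≠ x := fun h' => hx ⟨_, h'.symm⟩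
      have h4 := lt_of_le_of_ne h1 h3
      push_cast
      constructor <;> linarith
    rw [this]; push_cast; ring

lemma ded_neg (d c : ℤ) : dedekindSum (-d) c = -dedekindSum d c := by
  unfold dedekindSum
  rw [← Finset.sum_neg_distrib]
  refine Finset.sum_congr rfl fun k _ => ?_
  have : (k : ℝ) * ((-d : ℤ) : ℝ) / (c : ℝ) = -((k : ℝ) * (d : ℝ) / c) := by push_cast; ring
  rw [this, saw_neg]; ring

lemma ded_add (d c n : ℤ) (hc : c ≠ 0) : dedekindSum (d + n * c) c = dedekindSum d c := by
  unfold dedekindSum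
  refine Finset.sum_congr rfl fun k _ => ?_
  have hc' : (c : ℝ) ≠ 0 := by exact_mod_cast hc
  have : (k : ℝ) * ((d + n * c : ℤ) : ℝ) / (c : ℝ) = (k : ℝ) * (d : ℝ) / c + ((k * n : ℤ) : ℝ) := by
    push_cast; field_simp
  rw [this, saw_add_int]

lemma saw_int (n : ℤ) : saw n = 0 := by
  unfold saw; rw [if_pos ⟨n, rfl⟩]

lemma saw_nat_div (m k : ℕ) (hk : 0 < k) (h : m % k ≠ 0) :
    saw ((m : ℝ) / k) = ((m % k : ℕ) : ℝ) / k - 1 / 2 := by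
  have hk' : (0 : ℝ) < k := by exact_mod_cast hk
  have hm : (m : ℝ) = k * ((m / k : ℕ) : ℝ) + ((m % k : ℕ) : ℝ) := by
    exact_mod_cast (Nat.div_add_mod m k).symm
  have e : (m : ℝ) / k = ((m % k : ℕ) : ℝ) / k + (((m / k : ℕ) : ℤ) : ℝ) := by
    rw [Int.cast_natCast, div_add' _ _ _ hk'.ne']
    congr 1
    linarith
  rw [e, saw_add_int]
  have hlt : m % k < k := Nat.mod_lt _ hk
  have h0 : (0 : ℝ) < ((m % k : ℕ) : ℝ) := by exact_mod_cast Nat.pos_of_ne_zero h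
  have h1 : ((m % k : ℕ) : ℝ) < k := by exact_mod_cast hlt
  have f0 : 0 < ((m % k : ℕ) : ℝ) / k := by positivity
  have f1 : ((m % k : ℕ) : ℝ) / k < 1 := by rw [div_lt_one hk']; exact h1
  have hf : ⌊((m % k : ℕ) : ℝ) / k⌋ = 0 := by
    rw [Int.floor_eq_iff]; constructor <;> push_cast <;> linarith
  unfold saw
  rw [if_neg, hf]
  · push_cast; ring
  · rintro ⟨n, hn⟩
    rw [hn] at f0 f1
    have a : 0 < n := by exact_mod_cast f0
    have b : n < 1 := by exact_mod_cast f1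
    omega

lemma ded_nat (h k : ℕ) (hk : 0 < k) (hc : Nat.Coprime h k) :
    dedekindSum h k =
      ∑ i ∈ Finset.range k, ((i : ℝ) / k - 1 / 2) * (((h * i % k : ℕ) : ℝ) / k - 1 / 2) - 1 / 4 := by
  unfold dedekindSum
  have hk' : (k : ℝ) ≠ 0 := by positivity
  rw [Int.natAbs_natCast]
  obtain ⟨n, rfl⟩ : ∃ n, k = n + 1 := ⟨k - 1, by omega⟩
  rw [Finset.sum_Icc_succ_top (by omega), Finset.sum_range_succ']
  have e1 : saw (((n + 1 : ℕ) : ℝ) / (((n + 1 : ℕ) : ℤ) : ℝ)) = 0 := by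
    have : (((n + 1 : ℕ) : ℝ) / (((n + 1 : ℕ) : ℤ) : ℝ)) = ((1 : ℤ) : ℝ) := by
      rw [Int.cast_natCast, div_self hk']; simp
    rw [this, saw_int]
  rw [e1]
  have : ∑ k ∈ Finset.Icc 1 n, saw ((k : ℝ) / (((n + 1 : ℕ) : ℤ) : ℝ)) *
      saw ((k : ℝ) * ((h : ℤ) : ℝ) / (((n + 1 : ℕ) : ℤ) : ℝ)) =
      ∑ i ∈ Finset.range n, (((i + 1 : ℕ) : ℝ) / ((n + 1 : ℕ) : ℝ) - 1 / 2) *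
        (((h * (i + 1) % (n + 1) : ℕ) : ℝ) / ((n + 1 : ℕ) : ℝ) - 1 / 2) := by
    rw [Finset.range_eq_Ico, Finset.sum_Ico_add' (fun i : ℕ => (((i : ℕ) : ℝ) / ((n + 1 : ℕ) : ℝ) - 1 / 2) *
        (((h * i % (n + 1) : ℕ) : ℝ) / ((n + 1 : ℕ) : ℝ) - 1 / 2)) 0 n 1]
    refine Finset.sum_congr (by ext; simp) fun i hi => ?_
    simp only [Finset.mem_Ico] at hi
    have m1 : i % (n + 1) = i := Nat.mod_eq_of_lt (by omega)
    have m2 : h * i % (n + 1) ≠ 0 := by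
      intro h0
      have := (Nat.Coprime.dvd_of_dvd_mul_left hc.symm (Nat.dvd_of_mod_eq_zero h0))
      have := Nat.le_of_dvd (by omega) this
      omega
    have s1 := saw_nat_div i (n + 1) hk (by omega)
    have s2 := saw_nat_div (h * i) (n + 1) hk m2
    rw [m1] at s1
    rw [Int.cast_natCast, Int.cast_natCast, s1, ← s2]
    congr 2
    push_cast; ring
  rw [this]
  simp
  ring

lemma perm_sum (h k : ℕ) (hk : 0 < k) (hc : Nat.Coprime h k) (F : ℕ → ℝ) :
    ∑ i ∈ Finset.range k, F (h * i % k) = ∑ i ∈ Finset.range k, F i := by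
  have hmap : ∀ i ∈ Finset.range k, h * i % k ∈ Finset.range k := fun i _ =>
    Finset.mem_range.2 (Nat.mod_lt _ hk)
  have hinj : Set.InjOn (fun i => h * i % k) (Finset.range k : Set ℕ) := by
    intro a ha b hb hab
    simp only [Finset.coe_range, Set.mem_Iio] at ha hb
    have : h * a ≡ h * b [MOD k] := hab
    have := Nat.ModEq.cancel_left_of_coprime (by simpa [Nat.coprime_comm] using hc.symm) this
    exact Nat.ModEq.eq_of_lt_of_lt this ha hb
  exact Finset.sum_nbij (fun i => h * i % k) hmap hinj
    (Finset.surjOn_of_injOn_of_card_le _ hmap hinj le_rfl) (fun _ _ => rfl)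

lemma sum_id (k : ℕ) : ∑ i ∈ Finset.range k, (i : ℝ) = k * (k - 1) / 2 := by
  induction k with
  | zero => simp
  | succ n ih => rw [Finset.sum_range_succ, ih]; push_cast; ring

lemma sum_sq (k : ℕ) : ∑ i ∈ Finset.range k, (i : ℝ) ^ 2 = k * (k - 1) * (2 * k - 1) / 6 := by
  induction k with
  | zero => simp
  | succ n ih => rw [Finset.sum_range_succ, ih]; push_cast; ring

/-- lattice point double count -/
lemma double_count (h k : ℕ) (hh : 0 < h) (hk : 0 < k) (hc : Nat.Coprime h k) :
    ∑ i ∈ Finset.range k, ((h * i / k : ℕ) : ℝ) * (((h * i / k : ℕ) : ℝ) + 1) =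
      ∑ j ∈ Finset.range h, 2 * (j : ℝ) * ((k : ℝ) - 1 - ((k * j / h : ℕ) : ℝ)) := by
  have L : ∀ i ∈ Finset.range k, ((h * i / k : ℕ) : ℝ) * (((h * i / k : ℕ) : ℝ) + 1) =
      ∑ j ∈ Finset.range h, if k * j ≤ h * i then 2 * (j : ℝ) else 0 := by
    intro i hi
    rw [← Finset.sum_filter]
    have : (Finset.range h).filter (fun j => k * j ≤ h * i) = Finset.range (h * i / k + 1) := by
      ext j
      have hi' := Finset.mem_range.1 hi
      simp only [Finset.mem_filter, Finset.mem_range, Nat.lt_succ_iff, Nat.le_div_iff_mul_le hk]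
      constructor
      · rintro ⟨_, h2⟩; linarith [mul_comm k j]
      · intro h2
        have h3 : k * j ≤ h * i := by linarith [mul_comm k j]
        refine ⟨?_, h3⟩
        by_contra hj
        push Not at hj
        have : k * h ≤ k * j := Nat.mul_le_mul_left _ hj
        have : h * i < h * k := Nat.mul_lt_mul_of_pos_left hi' hh
        linarith [mul_comm h k]
    rw [this, ← Finset.mul_sum, sum_id]; push_cast; ring
  rw [Finset.sum_congr rfl L, Finset.sum_comm]
  refine Finset.sum_congr rfl fun j hj => ?_
  rw [← Finset.sum_filter, Finset.sum_const, nsmul_eq_mul]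
  rcases Nat.eq_zero_or_pos j with rfl | hj0
  · simp
  have hj' := Finset.mem_range.1 hj
  have : (Finset.range k).filter (fun i => k * j ≤ h * i) = Finset.Ico (k * j / h + 1) k := by
    ext i
    simp only [Finset.mem_filter, Finset.mem_range, Finset.mem_Ico, Nat.succ_le_iff,
      Nat.div_lt_iff_lt_mul hh]
    constructor
    · rintro ⟨h1, h2⟩
      refine ⟨lt_of_le_of_ne (by linarith [mul_comm h i]) ?_, h1⟩
      intro he
      have : h ∣ k * j := ⟨i, by rw [he, mul_comm]⟩
      have := Nat.le_of_dvd hj0 (Nat.Coprime.dvd_of_dvd_mul_left hc this)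
      omega
    · rintro ⟨h1, h2⟩; exact ⟨h2, by linarith [mul_comm h i]⟩
  rw [this, Nat.card_Ico]
  have hlt : k * j / h + 1 ≤ k := by
    rw [Nat.succ_le_iff, Nat.div_lt_iff_lt_mul hh]
    exact Nat.mul_lt_mul_of_pos_left hj' hk
  rw [Nat.cast_sub hlt]; push_cast; ring

lemma recip (h k : ℕ) (hh : 0 < h) (hk : 0 < k) (hc : Nat.Coprime h k) :
    dedekindSum h k + dedekindSum k h =
      -(1 / 4) + ((h : ℝ) / k + k / h + 1 / (h * k)) / 12 := by
  have hh' : (h : ℝ) ≠ 0 := by positivity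
  have hk' : (k : ℝ) ≠ 0 := by positivity
  have main : ∀ (h k : ℕ), 0 < k → Nat.Coprime h k →
      (∑ i ∈ Finset.range k, ((h * i / k : ℕ) : ℝ) = (h - 1) * (k - 1) / 2) ∧
      (dedekindSum h k = h * (k - 1) * (2 * k - 1) / (6 * k) -
        (∑ i ∈ Finset.range k, (i : ℝ) * ((h * i / k : ℕ) : ℝ)) / k - (k - 1) / 4) ∧
      ((k : ℝ) ^ 2 * ∑ i ∈ Finset.range k, ((h * i / k : ℕ) : ℝ) ^ 2 =
        2 * h * k * (∑ i ∈ Finset.range k, (i : ℝ) * ((h * i / k : ℕ) : ℝ))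
          + (1 - (h : ℝ) ^ 2) * (k * (k - 1) * (2 * k - 1) / 6)) := by
    intro h k hk hc
    have hk' : (k : ℝ) ≠ 0 := by positivity
    have hr : ∀ i, ((h * i % k : ℕ) : ℝ) = h * i - k * ((h * i / k : ℕ) : ℝ) := by
      intro i
      have : ((k * (h * i / k) + h * i % k : ℕ) : ℝ) = ((h * i : ℕ) : ℝ) := by
        rw [Nat.div_add_mod]
      push_cast at this ⊢
      linarith
    have p1 := perm_sum h k hk hc (fun i => (i : ℝ))
    have p2 := perm_sum h k hk hc (fun i => (i : ℝ) ^ 2)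
    simp only [hr] at p1 p2
    rw [sum_id, Finset.sum_sub_distrib, ← Finset.mul_sum, ← Finset.mul_sum, sum_id] at p1
    have q : ∀ i : ℕ, ((h : ℝ) * i - k * ((h * i / k : ℕ) : ℝ)) ^ 2 =
        h ^ 2 * (i : ℝ) ^ 2 - 2 * h * k * (i * ((h * i / k : ℕ) : ℝ))
          + k ^ 2 * ((h * i / k : ℕ) : ℝ) ^ 2 := by intro i; ring
    simp only [q] at p2
    rw [sum_sq, Finset.sum_add_distrib, Finset.sum_sub_distrib, ← Finset.mul_sum,
      ← Finset.mul_sum, ← Finset.mul_sum, sum_sq] at p2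
    have f1 : ∑ i ∈ Finset.range k, ((h * i / k : ℕ) : ℝ) = (h - 1) * (k - 1) / 2 := by
      apply mul_left_cancel₀ hk'
      linarith
    refine ⟨f1, ?_, by linarith⟩
    rw [ded_nat h k hk hc]
    have q2 : ∀ i : ℕ, ((i : ℝ) / k - 1 / 2) * (((h * i % k : ℕ) : ℝ) / k - 1 / 2) =
        (h / k ^ 2) * (i : ℝ) ^ 2 - (1 / k) * (i * ((h * i / k : ℕ) : ℝ)) - (1 / (2 * k) + h / (2 * k)) * i
          + (1 / 2) * ((h * i / k : ℕ) : ℝ) + 1 / 4 := by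
      intro i; rw [hr]; field_simp; ring
    simp only [q2]
    rw [Finset.sum_add_distrib, Finset.sum_add_distrib, Finset.sum_sub_distrib,
      Finset.sum_sub_distrib, ← Finset.mul_sum, ← Finset.mul_sum, ← Finset.mul_sum,
      ← Finset.mul_sum, f1, sum_sq, sum_id, Finset.sum_const, Finset.card_range, nsmul_eq_mul]
    field_simp; ring
  obtain ⟨a1, a2, a3⟩ := main h k hk hc
  obtain ⟨b1, b2, b3⟩ := main k h hh hc.symm
  have dc := double_count h k hh hk hc
  have dl : ∀ x : ℝ, x * (x + 1) = x ^ 2 + x := fun x => by ring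
  have dr : ∀ j : ℕ, 2 * (j : ℝ) * ((k : ℝ) - 1 - ((k * j / h : ℕ) : ℝ)) =
      (2 * (k - 1)) * j - 2 * (j * ((k * j / h : ℕ) : ℝ)) := fun j => by ring
  simp only [dl, dr] at dc
  rw [Finset.sum_add_distrib, Finset.sum_sub_distrib, ← Finset.mul_sum, ← Finset.mul_sum, a1,
    sum_id] at dc
  rw [a2, b2]
  generalize (∑ i ∈ Finset.range k, (i : ℝ) * ((h * i / k : ℕ) : ℝ)) = X at *
  generalize (∑ i ∈ Finset.range h, (i : ℝ) * ((k * i / h : ℕ) : ℝ)) = Y at *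
  generalize (∑ i ∈ Finset.range k, ((h * i / k : ℕ) : ℝ) ^ 2) = Z at *
  have hZ : Z = (2 * (k - 1)) * (h * (h - 1) / 2) - 2 * Y - (h - 1) * (k - 1) / 2 := by linarith
  rw [hZ] at a3
  have hX : X = ((k : ℝ) ^ 2 * ((2 * (k - 1)) * (h * (h - 1) / 2) - 2 * Y - (h - 1) * (k - 1) / 2)
      - (1 - (h : ℝ) ^ 2) * (k * (k - 1) * (2 * k - 1) / 6)) / (2 * h * k) := by
    rw [eq_div_iff (by positivity)]; linarith
  rw [hX]
  field_simp
  ring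

def PhiR (a b c d : ℤ) : ℝ :=
  if c = 0 then (b : ℝ) / d
  else ((a : ℝ) + d) / c - 12 * (Int.sign c : ℝ) * dedekindSum d ((c.natAbs : ℤ))

lemma phi_T (a b c d n : ℤ) (h : a * d - b * c = 1) :
    PhiR a (a * n + b) c (c * n + d) = PhiR a b c d + n := by
  unfold PhiR
  by_cases hc : c = 0
  · subst hc
    have : d = 1 ∧ a = 1 ∨ d = -1 ∧ a = -1 := by
      have h' : a * d = 1 := by linarith
      rcases Int.mul_eq_one_iff_eq_one_or_neg_one.1 h' with h | h <;> tauto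
    rcases this with ⟨rfl, rfl⟩ | ⟨rfl, rfl⟩ <;> simp <;> ring
  · rw [if_neg hc, if_neg hc]
    have hc' : (c : ℝ) ≠ 0 := by exact_mod_cast hc
    have hn : ((c.natAbs : ℤ)) ≠ 0 := by simpa using hc
    have e : c * n + d = d + (c.sign * n) * (c.natAbs : ℤ) := by
      have := Int.sign_mul_natAbs c
      linear_combination (-n) * this
    have : dedekindSum (c * n + d) (c.natAbs : ℤ) = dedekindSum d (c.natAbs : ℤ) := by
      rw [e, ded_add _ _ _ hn]
    rw [this]; push_cast; field_simp; ring

lemma ded_zero (c : ℤ) : dedekindSum 0 c = 0 := by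
  have := ded_neg 0 c
  simp at this; linarith

lemma ded_abs (d c : ℤ) : dedekindSum d c = (Int.sign d : ℝ) * dedekindSum (d.natAbs : ℤ) c := by
  rcases lt_trichotomy d 0 with h | h | h
  · have e : d = -(d.natAbs : ℤ) := by omega
    rw [Int.sign_eq_neg_one_of_neg h]
    conv_lhs => rw [e, ded_neg]
    simp
  · subst h; simp [ded_zero]
  · have e : d = (d.natAbs : ℤ) := by omega
    rw [Int.sign_eq_one_of_pos h]
    conv_lhs => rw [e]
    simp

lemma phi_S (a b c d : ℤ) (h : a * d - b * c = 1) :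
    PhiR b (-a) d (-c) = PhiR a b c d - 3 * (Int.sign (c * d) : ℝ) := by
  unfold PhiR
  by_cases hc : c = 0
  · subst hc
    have hd : d ≠ 0 := by rintro rfl; simp at h
    simp [hd, ded_zero]
  by_cases hd : d = 0
  · subst hd
    simp [hc, ded_zero, neg_div_neg_eq]
  rw [if_neg hc, if_neg hd, ded_neg, ded_abs c, ded_abs d]
  have hcop : Nat.Coprime d.natAbs c.natAbs := by
    have : IsCoprime d c := ⟨a, -b, by linarith⟩
    exact Int.isCoprime_iff_gcd_eq_one.1 this
  have R := recip d.natAbs c.natAbs (by omega) (by omega) hcop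
  have hd' : (d : ℝ) ≠ 0 := by exact_mod_cast hd
  have hc' : (c : ℝ) ≠ 0 := by exact_mod_cast hc
  have ed : ((d.natAbs : ℕ) : ℝ) = Int.sign d * d := by
    have := congrArg (Int.cast : ℤ → ℝ) (Int.sign_mul_self_eq_natAbs d)
    rw [Int.cast_mul, Int.cast_natCast] at this
    exact this.symm
  have ec : ((c.natAbs : ℕ) : ℝ) = Int.sign c * c := by
    have := congrArg (Int.cast : ℤ → ℝ) (Int.sign_mul_self_eq_natAbs c)
    rw [Int.cast_mul, Int.cast_natCast] at this
    exact this.symm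
  rw [ed, ec] at R
  rw [Int.sign_mul]
  have sd : (Int.sign d : ℝ) = 1 ∨ (Int.sign d : ℝ) = -1 := by
    rcases lt_or_gt_of_ne hd with h | h
    · right; rw [Int.sign_eq_neg_one_of_neg h]; simp
    · left; rw [Int.sign_eq_one_of_pos h]; simp
  have sc : (Int.sign c : ℝ) = 1 ∨ (Int.sign c : ℝ) = -1 := by
    rcases lt_or_gt_of_ne hc with h | h
    · right; rw [Int.sign_eq_neg_one_of_neg h]; simp
    · left; rw [Int.sign_eq_one_of_pos h]; simp
  have hR : (a : ℝ) * d - b * c = 1 := by exact_mod_cast h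
  simp only [Int.cast_neg, Int.cast_mul]
  have R' : dedekindSum (c.natAbs : ℤ) (d.natAbs : ℤ) = -(1 / 4) + ((Int.sign d * d : ℝ) / (Int.sign c * c) + (Int.sign c * c) / (Int.sign d * d) + 1 / ((Int.sign d * d) * (Int.sign c * c))) / 12 - dedekindSum (d.natAbs : ℤ) (c.natAbs : ℤ) := by
    linarith
  rw [R']
  generalize dedekindSum (d.natAbs : ℤ) (c.natAbs : ℤ) = X
  rcases sd with sd | sd <;> rcases sc with sc | sc <;> rw [sd, sc] <;> field_simp <;>
    linear_combination (-4) * hR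

def PhiM (g : Matrix (Fin 2) (Fin 2) ℤ) : ℝ := PhiR (g 0 0) (g 0 1) (g 1 0) (g 1 1)

lemma sign_id (c1 c2 d2 c3 d3 : ℤ) (h : c3 * d2 - d3 * c2 = c1) (h2 : c2 ≠ 0 ∨ d2 ≠ 0)
    (h3 : c3 ≠ 0 ∨ d3 ≠ 0) :
    Int.sign (c1 * c2 * c3) + Int.sign (c3 * d3) = Int.sign (c2 * d2) + Int.sign (c1 * d2 * d3) := by
  simp only [Int.sign_mul]
  rw [← h]
  have key : ∀ x y : ℤ, 0 < x → y < 0 → Int.sign (x - y) = 1 := fun x y hx hy =>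
    Int.sign_eq_one_of_pos (by linarith)
  have key2 : ∀ x y : ℤ, x < 0 → 0 < y → Int.sign (x - y) = -1 := fun x y hx hy =>
    Int.sign_eq_neg_one_of_neg (by linarith)
  rcases lt_trichotomy c2 0 with p | p | p <;> rcases lt_trichotomy d2 0 with q | q | q <;>
  rcases lt_trichotomy c3 0 with r | r | r <;> rcases lt_trichotomy d3 0 with s | s | s <;>
  first
  | (exfalso; omega)
  | (simp [p, q, r, s, Int.sign_eq_one_of_pos, Int.sign_eq_neg_one_of_neg]; done)
  | (simp only [p, q, r, s, Int.sign_eq_one_of_pos, Int.sign_eq_neg_one_of_neg]; ring1)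
  | (rw [key (c3 * d2) (d3 * c2) (by nlinarith) (by nlinarith)]
     simp [p, q, r, s, Int.sign_eq_one_of_pos, Int.sign_eq_neg_one_of_neg])
  | (rw [key2 (c3 * d2) (d3 * c2) (by nlinarith) (by nlinarith)]
     simp [p, q, r, s, Int.sign_eq_one_of_pos, Int.sign_eq_neg_one_of_neg])

lemma phiM_T (g : Matrix (Fin 2) (Fin 2) ℤ) (h : g.det = 1) (n : ℤ) :
    PhiM (g * !![1, n; 0, 1]) = PhiM g + n := by
  rw [Matrix.det_fin_two] at h
  have := phi_T _ _ _ _ n h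
  simpa [PhiM, Matrix.mul_apply, Fin.sum_univ_two] using this

lemma phiM_S (g : Matrix (Fin 2) (Fin 2) ℤ) (h : g.det = 1) :
    PhiM (g * !![0, -1; 1, 0]) = PhiM g - 3 * (Int.sign (g 1 0 * g 1 1) : ℝ) := by
  rw [Matrix.det_fin_two] at h
  have := phi_S _ _ _ _ h
  simpa [PhiM, Matrix.mul_apply, Fin.sum_univ_two] using this

lemma phiM_S' (g : Matrix (Fin 2) (Fin 2) ℤ) (h : g.det = 1) :
    PhiM (g * !![0, 1; -1, 0]) = PhiM g - 3 * (Int.sign (g 1 0 * g 1 1) : ℝ) := by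
  have hd : (g * !![0, 1; -1, 0]).det = 1 := by rw [Matrix.det_mul, h]; simp [Matrix.det_fin_two]
  have := phiM_S _ hd
  have e : g * !![0, 1; -1, 0] * !![0, -1; 1, 0] = g := by
    rw [Matrix.mul_assoc]
    ext i j
    fin_cases i <;> fin_cases j <;> simp [Matrix.mul_apply, Fin.sum_univ_two]
  rw [e] at this
  simp [Matrix.mul_apply, Fin.sum_univ_two] at this ⊢
  rw [this]; ring_nf

def PhiP (g₁ g₂ : Matrix (Fin 2) (Fin 2) ℤ) : Prop :=
  PhiM (g₁ * g₂) = PhiM g₁ + PhiM g₂ - 3 * (Int.sign (g₁ 1 0 * g₂ 1 0 * (g₁ * g₂) 1 0) : ℝ)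

lemma row_ne (g : Matrix (Fin 2) (Fin 2) ℤ) (h : g.det = 1) : g 1 0 ≠ 0 ∨ g 1 1 ≠ 0 := by
  rw [Matrix.det_fin_two] at h
  by_contra hh
  push Not at hh
  rw [hh.1, hh.2] at h; simp at h

lemma phiP_T (g₁ g₂ : Matrix (Fin 2) (Fin 2) ℤ) (h₁ : g₁.det = 1) (h₂ : g₂.det = 1) (n : ℤ)
    (hP : PhiP g₁ g₂) : PhiP g₁ (g₂ * !![1, n; 0, 1]) := by
  unfold PhiP at *
  have e : (g₂ * !![1, n; 0, 1]) 1 0 = g₂ 1 0 := by simp [Matrix.mul_apply, Fin.sum_univ_two]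
  have e' : (g₁ * g₂ * !![1, n; 0, 1]) 1 0 = (g₁ * g₂) 1 0 := by
    simp [Matrix.mul_apply, Fin.sum_univ_two]
  rw [← Matrix.mul_assoc, phiM_T _ (by rw [Matrix.det_mul, h₁, h₂, mul_one]), phiM_T _ h₂, hP, e, e']
  ring

lemma sign_id' (g₁ g₂ : Matrix (Fin 2) (Fin 2) ℤ) (h₁ : g₁.det = 1) (h₂ : g₂.det = 1) :
    (Int.sign (g₁ 1 0 * g₂ 1 0 * (g₁ * g₂) 1 0) : ℝ) + Int.sign ((g₁ * g₂) 1 0 * (g₁ * g₂) 1 1) =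
      Int.sign (g₂ 1 0 * g₂ 1 1) + Int.sign (g₁ 1 0 * g₂ 1 1 * (g₁ * g₂) 1 1) := by
  have := sign_id (g₁ 1 0) (g₂ 1 0) (g₂ 1 1) ((g₁ * g₂) 1 0) ((g₁ * g₂) 1 1) ?_ (row_ne _ h₂)
    (row_ne _ (by rw [Matrix.det_mul, h₁, h₂, mul_one]))
  · exact_mod_cast this
  · rw [Matrix.det_fin_two] at h₂
    simp only [Matrix.mul_apply, Fin.sum_univ_two]
    linear_combination (g₁ 1 0) * h₂

lemma phiP_S (g₁ g₂ : Matrix (Fin 2) (Fin 2) ℤ) (h₁ : g₁.det = 1) (h₂ : g₂.det = 1)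
    (hP : PhiP g₁ g₂) : PhiP g₁ (g₂ * !![0, -1; 1, 0]) := by
  unfold PhiP at *
  have e : (g₂ * (!![0, -1; 1, 0] : Matrix (Fin 2) (Fin 2) ℤ)) 1 0 = g₂ 1 1 := by simp [Matrix.mul_apply, Fin.sum_univ_two]
  have e' : (g₁ * g₂ * (!![0, -1; 1, 0] : Matrix (Fin 2) (Fin 2) ℤ)) 1 0 = (g₁ * g₂) 1 1 := by
    simp [Matrix.mul_apply, Fin.sum_univ_two]
  rw [← Matrix.mul_assoc, phiM_S _ (by rw [Matrix.det_mul, h₁, h₂, mul_one]), phiM_S _ h₂, hP, e, e']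
  linear_combination (-3) * sign_id' g₁ g₂ h₁ h₂

lemma phiP_S' (g₁ g₂ : Matrix (Fin 2) (Fin 2) ℤ) (h₁ : g₁.det = 1) (h₂ : g₂.det = 1)
    (hP : PhiP g₁ g₂) : PhiP g₁ (g₂ * !![0, 1; -1, 0]) := by
  unfold PhiP at *
  have e : (g₂ * (!![0, 1; -1, 0] : Matrix (Fin 2) (Fin 2) ℤ)) 1 0 = -g₂ 1 1 := by simp [Matrix.mul_apply, Fin.sum_univ_two]
  have e' : (g₁ * g₂ * (!![0, 1; -1, 0] : Matrix (Fin 2) (Fin 2) ℤ)) 1 0 = -(g₁ * g₂) 1 1 := by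
    simp [Matrix.mul_apply, Fin.sum_univ_two]
  rw [← Matrix.mul_assoc, phiM_S' _ (by rw [Matrix.det_mul, h₁, h₂, mul_one]), phiM_S' _ h₂, hP, e, e']
  have e'' : g₁ 1 0 * -g₂ 1 1 * -(g₁ * g₂) 1 1 = g₁ 1 0 * g₂ 1 1 * (g₁ * g₂) 1 1 := by ring
  rw [e'']
  linear_combination (-3) * sign_id' g₁ g₂ h₁ h₂

lemma phiP_all (g₁ g₂ : Matrix (Fin 2) (Fin 2) ℤ) (h₁ : g₁.det = 1) (h₂ : g₂.det = 1) :
    PhiP g₁ g₂ := by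
  have key : ∀ x : Matrix.SpecialLinearGroup (Fin 2) ℤ, PhiP g₁ (x : Matrix (Fin 2) (Fin 2) ℤ) := by
    intro x
    have hx : x ∈ Subgroup.closure {ModularGroup.S, ModularGroup.T} := by
      simp [SpecialLinearGroup.SL2Z_generators]
    induction hx using Subgroup.closure_induction_right with
    | one => simp [PhiP, PhiM, PhiR]
    | mul_right x hx y hy ih =>
      rcases hy with rfl | rfl
      · exact phiP_S _ _ h₁ x.2 ih
      · exact phiP_T _ _ h₁ x.2 1 ih
    | mul_inv_cancel x hx y hy ih =>
      rcases hy with rfl | rfl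
      · have := phiP_S' _ _ h₁ x.2 ih
        rw [Matrix.SpecialLinearGroup.coe_mul, Matrix.SpecialLinearGroup.coe_inv]
        simpa [ModularGroup.S, Matrix.adjugate_fin_two] using this
      · have := phiP_T _ _ h₁ x.2 (-1) ih
        rw [Matrix.SpecialLinearGroup.coe_mul, Matrix.SpecialLinearGroup.coe_inv]
        simpa [ModularGroup.T, Matrix.adjugate_fin_two] using this
  exact key ⟨g₂, h₂⟩

def psiM (g : Matrix (Fin 2) (Fin 2) ℤ) : ℝ :=
  if g 1 0 = 0 then (1 - (Int.sign (g 1 1) : ℝ)) / 4 else -(Int.sign (g 1 0) : ℝ) / 4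

lemma asai_eq (g : Matrix (Fin 2) (Fin 2) ℤ) : asai g = PhiM g / 12 + psiM g := by
  unfold asai PhiM PhiR psiM
  split_ifs with h
  · rw [div_div]; ring_nf
  · rw [← div_div]; ring_nf

lemma real_sign_cast (n : ℤ) : Real.sign (n : ℝ) = (Int.sign n : ℝ) := by
  rcases lt_trichotomy n 0 with h | h | h
  · rw [Int.sign_eq_neg_one_of_neg h, Real.sign_of_neg (by exact_mod_cast h)]; simp
  · subst h; simp
  · rw [Int.sign_eq_one_of_pos h, Real.sign_of_pos (by exact_mod_cast h)]; simp

lemma mX_eq (g : Matrix (Fin 2) (Fin 2) ℤ) :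
    mX (toR g) = Complex.exp (Complex.I * Real.pi * (psiM g : ℂ)) := by
  unfold mX psiM toR
  simp only [Matrix.map_apply, real_sign_cast, Int.cast_eq_zero]
  split_ifs with h
  · congr 1; push_cast; ring
  · congr 1; push_cast; ring

lemma btilde_eq (g : Matrix (Fin 2) (Fin 2) ℤ) :
    btilde1 g = Complex.exp (-(Complex.I * Real.pi / 12 * (PhiM g : ℂ))) := by
  rw [btilde1, mX_eq, asai_eq, ← Complex.exp_add]
  congr 1; push_cast; ring

lemma part1 (g₁ g₂ : Matrix (Fin 2) (Fin 2) ℤ) (h₁ : g₁.det = 1) (h₂ : g₂.det = 1) :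
    Complex.exp (Complex.I * (Real.pi : ℂ) / 4 *
        (Int.sign (g₁ 1 0 * g₂ 1 0 * (g₁ * g₂) 1 0) : ℂ)) =
      (btilde1 g₁)⁻¹ * (btilde1 g₂)⁻¹ * btilde1 (g₁ * g₂) := by
  rw [btilde_eq, btilde_eq, btilde_eq, ← Complex.exp_neg, ← Complex.exp_neg, ← Complex.exp_add,
    ← Complex.exp_add]
  have h := phiP_all g₁ g₂ h₁ h₂
  unfold PhiP at h
  have h' : (PhiM (g₁ * g₂) : ℂ) = PhiM g₁ + PhiM g₂ -
    3 * (Int.sign (g₁ 1 0 * g₂ 1 0 * (g₁ * g₂) 1 0) : ℂ) := by exact_mod_cast congrArg Complex.ofReal h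
  rw [h']
  congr 1; ring

open Complex in
lemma arg_unique (x y : ℝ) (h : Complex.exp (x * I) = Complex.exp (y * I))
    (hxy : |x - y| < 2 * Real.pi) : x = y := by
  rw [Complex.exp_eq_exp_iff_exists_int] at h
  obtain ⟨n, hn⟩ := h
  have h2 : (x : ℂ) = y + n * (2 * Real.pi) := by
    apply mul_right_cancel₀ I_ne_zero
    rw [hn]; ring
  have h3 : x = y + n * (2 * Real.pi) := by exact_mod_cast h2
  have hp := Real.pi_pos
  have h4 : x - y = n * (2 * Real.pi) := by linarith
  rw [h4, abs_mul, abs_of_pos (by positivity : (0 : ℝ) < 2 * Real.pi)] at hxy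
  have h5 : |(n : ℝ)| < 1 := by
    by_contra hc
    push Not at hc
    nlinarith
  have h6 : |n| < 1 := by exact_mod_cast h5
  have h7 : n = 0 := Int.abs_lt_one_iff.1 h6
  rw [h3, h7]; simp

open Complex in
lemma exp_arg (z : ℂ) (hz : z ≠ 0) : Complex.exp (arg z * I) = z / ‖z‖ := by
  have h := Complex.norm_mul_exp_arg_mul_I z
  have : (‖z‖ : ℂ) ≠ 0 := by exact_mod_cast norm_ne_zero_iff.2 hz
  rw [eq_div_iff this, mul_comm]; exact h

open Complex in
lemma arg_bd (z : ℂ) (hz : 0 < z.re) : -(Real.pi / 2) < arg z ∧ arg z < Real.pi / 2 := by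
  have := Complex.abs_arg_lt_pi_div_two_iff.2 (Or.inl hz)
  exact abs_lt.1 this

lemma ne_of_re (z : ℂ) (hz : 0 < z.re) : z ≠ 0 := by
  rintro rfl; simp at hz

open Complex in
/-- four arguments lemma -/
lemma four_arg (A B p P : ℂ) (hA : 0 < A.re) (hB : 0 < B.re) (hp : 0 < p.re) (hP : 0 < P.re)
    (h : A = B * (p * (starRingEnd ℂ) P)) : arg A - arg B = arg p - arg P := by
  apply arg_unique
  · have a := exp_arg A (ne_of_re _ hA)
    have b := exp_arg B (ne_of_re _ hB)
    have c := exp_arg p (ne_of_re _ hp)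
    have d := exp_arg P (ne_of_re _ hP)
    push_cast
    rw [sub_mul, sub_mul, Complex.exp_sub, Complex.exp_sub, a, b, c, d, h]
    have nB : (‖B‖ : ℂ) ≠ 0 := by exact_mod_cast norm_ne_zero_iff.2 (ne_of_re _ hB)
    have np : (‖p‖ : ℂ) ≠ 0 := by exact_mod_cast norm_ne_zero_iff.2 (ne_of_re _ hp)
    have nP : (‖P‖ : ℂ) ≠ 0 := by exact_mod_cast norm_ne_zero_iff.2 (ne_of_re _ hP)
    have zB := ne_of_re _ hB
    have zP := ne_of_re _ hP
    have e : P * (starRingEnd ℂ) P = (‖P‖ : ℂ) ^ 2 := Complex.mul_conj' P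
    rw [norm_mul, norm_mul, RCLike.norm_conj]
    push_cast
    field_simp
    linear_combination p * e
  · have a := arg_bd _ hA
    have b := arg_bd _ hB
    have c := arg_bd _ hp
    have d := arg_bd _ hP
    rw [abs_lt]; constructor <;> linarith

open Complex in
/-- rotation lemma -/
lemma rot_arg (P u v : ℂ) (s : ℝ) (hs : s = 1 ∨ s = -1) (hP : 0 < P.re) (hu : 0 < u.re)
    (hv : 0 < v.re) (h : P * v = (s : ℂ) * (-I) * u) :
    arg P = -(Real.pi / 2 * s) + arg u - arg v := by
  apply arg_unique
  · have a := exp_arg P (ne_of_re _ hP)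
    have b := exp_arg u (ne_of_re _ hu)
    have c := exp_arg v (ne_of_re _ hv)
    push_cast
    rw [sub_mul, add_mul, Complex.exp_sub, Complex.exp_add, a, b, c]
    have e : Complex.exp (-(Real.pi / 2 * s) * I) = s * (-I) := by
      rcases hs with rfl | rfl
      · have : (-((Real.pi : ℂ) / 2 * ((1 : ℝ) : ℂ)) * I) = -(Real.pi / 2 * I) := by push_cast; ring
        rw [this, Complex.exp_neg, Complex.exp_pi_div_two_mul_I]; simp
      · have : (-((Real.pi : ℂ) / 2 * ((-1 : ℝ) : ℂ)) * I) = (Real.pi / 2 * I) := by push_cast; ring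
        rw [this, Complex.exp_pi_div_two_mul_I]; simp
    rw [e]
    have nu : (‖u‖ : ℂ) ≠ 0 := by exact_mod_cast norm_ne_zero_iff.2 (ne_of_re _ hu)
    have nv : (‖v‖ : ℂ) ≠ 0 := by exact_mod_cast norm_ne_zero_iff.2 (ne_of_re _ hv)
    have nP : (‖P‖ : ℂ) ≠ 0 := by exact_mod_cast norm_ne_zero_iff.2 (ne_of_re _ hP)
    have zv := ne_of_re _ hv
    have hn : ‖P‖ * ‖v‖ = ‖u‖ := by
      rw [← norm_mul, h, norm_mul, norm_mul, norm_neg, Complex.norm_I, Complex.norm_real]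
      rcases hs with rfl | rfl <;> simp
    have hn' : (‖u‖ : ℂ) = ‖P‖ * ‖v‖ := by exact_mod_cast hn.symm
    rw [hn']
    field_simp
    linear_combination h
  · have a := arg_bd _ hP
    have b := arg_bd _ hu
    have c := arg_bd _ hv
    rcases hs with rfl | rfl <;> rw [abs_lt] <;> constructor <;> linarith

open Complex in
def wv (c d : ℝ) : ℂ := if c = 0 then 1 else (Real.sign c : ℂ) * (c - d * I)

lemma sign_cases (c : ℝ) (hc : c ≠ 0) :
    (Real.sign c = 1 ∨ Real.sign c = -1) ∧ 0 < Real.sign c * c := by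
  rcases lt_or_gt_of_ne hc with h | h
  · rw [Real.sign_of_neg h]; exact ⟨Or.inr rfl, by linarith⟩
  · rw [Real.sign_of_pos h]; exact ⟨Or.inl rfl, by linarith⟩

lemma wv_re (c d : ℝ) : 0 < (wv c d).re := by
  unfold wv
  split_ifs with h
  · simp
  · have := (sign_cases c h).2
    simpa using this

open Complex in
lemma wv_ne (c d : ℝ) (h : c ≠ 0) : wv c d = (Real.sign c : ℂ) * (-I) * (c * I + d) := by
  unfold wv
  rw [if_neg h]
  linear_combination ((Real.sign c : ℂ) * c) * I_sq

open Complex in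
lemma myArg_eq (c d : ℝ) (h : c ≠ 0 ∨ d ≠ 0) :
    myArg (c * I + d) = arg (wv c d) -
      Real.pi * (if c = 0 then (1 - Real.sign d) / 2 else -Real.sign c / 2) := by
  by_cases hc : c = 0
  · subst hc
    have hd : d ≠ 0 := by simpa using h
    simp only [ofReal_zero, zero_mul, zero_add, wv, if_true, arg_one, myArg]
    rcases lt_or_gt_of_ne hd with h | h
    · rw [Complex.arg_ofReal_of_neg h, Real.sign_of_neg h]; simp
    · rw [Complex.arg_ofReal_of_nonneg h.le, Real.sign_of_pos h]; simp [Real.pi_ne_zero.symm]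
  · rw [if_neg hc]
    have hz : (c * I + d : ℂ) ≠ 0 := by
      intro h0
      have := congrArg Complex.im h0
      simp at this; exact hc this
    have hpi : arg (c * I + d) ≠ Real.pi := by
      rw [Ne, Complex.arg_eq_pi_iff]
      simp [hc]
    rw [myArg, if_neg hpi]
    have hw := wv_ne c d hc
    have hs := (sign_cases c hc).1
    have hre := wv_re c d
    apply arg_unique
    · rw [exp_arg _ hz]
      push_cast
      rw [sub_mul, Complex.exp_sub, exp_arg _ (ne_of_re _ hre), hw]
      have e : Complex.exp (Real.pi * (-(Real.sign c : ℂ) / 2) * I) = Real.sign c * (-I) := by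
        rcases hs with hs | hs <;> rw [hs]
        · have : ((Real.pi : ℂ) * (-((1 : ℝ) : ℂ) / 2) * I) = -(Real.pi / 2 * I) := by push_cast; ring
          rw [this, Complex.exp_neg, Complex.exp_pi_div_two_mul_I]; simp
        · have : ((Real.pi : ℂ) * (-((-1 : ℝ) : ℂ) / 2) * I) = (Real.pi / 2 * I) := by push_cast; ring
          rw [this, Complex.exp_pi_div_two_mul_I]; simp
      rw [e]
      have hn : ‖(Real.sign c : ℂ) * (-I) * (c * I + d)‖ = ‖(c * I + d : ℂ)‖ := by
        rw [norm_mul, norm_mul, norm_neg, Complex.norm_I, Complex.norm_real]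
        rcases hs with hs | hs <;> rw [hs] <;> simp
      rw [hn]
      have hs0 : (Real.sign c : ℂ) ≠ 0 := by
        rcases hs with hs | hs <;> rw [hs] <;> simp
      have := I_ne_zero
      field_simp
    · have a := arg_bd _ hre
      have b := Complex.arg_le_pi (c * I + d)
      have b' := Complex.neg_pi_lt_arg (c * I + d)
      have hp := Real.pi_pos
      have : (0 < c → 0 ≤ arg (c * I + d)) ∧ (c < 0 → arg (c * I + d) < 0) := by
        rw [Complex.arg_nonneg_iff, Complex.arg_neg_iff]
        simp; exact le_of_lt
      rcases lt_or_gt_of_ne hc with h | h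
      · have := this.2 h
        rw [Real.sign_of_neg h, abs_lt]; constructor <;> linarith
      · have := this.1 h
        rw [Real.sign_of_pos h, abs_lt]; constructor <;> linarith

open Complex in
lemma bhat_eq (g : Matrix (Fin 2) (Fin 2) ℤ) (h : g.det = 1) :
    bhat1 g = btilde1 g * Complex.exp (-(arg (wv (g 1 0) (g 1 1)) / 2 * I)) := by
  unfold bhat1 btilde1
  rw [mX_eq, mul_assoc (Complex.exp (-(Real.pi : ℂ) * Complex.I * (asai g : ℂ)))]
  congr 1
  unfold sbar
  have hr : ((g 1 0 : ℤ) : ℝ) ≠ 0 ∨ ((g 1 1 : ℤ) : ℝ) ≠ 0 := by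
    have := row_ne g h
    exact_mod_cast this
  have := myArg_eq _ _ hr
  simp only [toR, Matrix.map_apply]
  rw [this, ← Complex.exp_neg, ← Complex.exp_add]
  congr 1
  unfold psiM
  simp only [real_sign_cast, Int.cast_eq_zero]
  split_ifs <;> push_cast <;> ring

open Complex in
lemma gammaK_eq (z' z : ℂ) (h' : 0 < z'.im) (h : 0 < z.im) :
    gammaK z' z = Complex.exp ((((Real.log z'.im + Real.log z.im) / 4
      - Real.log ‖(z' - (starRingEnd ℂ) z) / (2 * I)‖ / 2 : ℝ) : ℂ)
      - arg ((z' - (starRingEnd ℂ) z) / (2 * I)) / 2 * I) := by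
  have hne : (z' - (starRingEnd ℂ) z) / (2 * I) ≠ 0 := by
    refine div_ne_zero ?_ (by simp)
    intro h0
    have := congrArg Complex.im h0
    simp at this; linarith
  unfold gammaK
  rw [Complex.cpow_def_of_ne_zero hne, Real.rpow_def_of_pos h', Real.rpow_def_of_pos h,
    Complex.ofReal_exp, Complex.ofReal_exp, ← Complex.exp_add, ← Complex.exp_add, Complex.log]
  congr 1
  push_cast
  ring

open Complex in
lemma re_pos_s8 (z' z : ℂ) (h' : 0 < z'.im) (h : 0 < z.im) :
    0 < ((z' - (starRingEnd ℂ) z) / (2 * I)).re := by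
  have : (z' - (starRingEnd ℂ) z) / (2 * I) = (z' - (starRingEnd ℂ) z) * (-I) / (2 : ℝ) := by
    rw [div_eq_div_iff (by simp) (by simp)]
    push_cast
    linear_combination (2 * (z' - (starRingEnd ℂ) z)) * I_sq
  rw [this, Complex.div_ofReal_re]
  simp
  linarith


open Complex in
lemma den_ne_s8 (a b c d : ℝ) (hdet : a * d - b * c = 1) (z : ℂ) (hz : 0 < z.im) : (c : ℂ) * z + d ≠ 0 := by
  intro h0
  have h1 := congrArg Complex.im h0
  have h2 := congrArg Complex.re h0
  simp at h1 h2
  rcases h1 with h1 | h1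
  · subst h1
    simp at h2
    subst h2
    simp at hdet
  · linarith

open Complex in
lemma mob_diff (a b c d : ℝ) (hdet : a * d - b * c = 1) (z' z : ℂ) (hz' : 0 < z'.im) (hz : 0 < z.im) :
    ((a : ℂ) * z' + b) / (c * z' + d) - (starRingEnd ℂ) (((a : ℂ) * z + b) / (c * z + d)) =
      (z' - (starRingEnd ℂ) z) / ((c * z' + d) * (starRingEnd ℂ) (c * z + d)) := by
  have n1 := den_ne_s8 a b c d hdet z' hz'
  have n2 := den_ne_s8 a b c d hdet z hz
  have n3 : (starRingEnd ℂ) ((c : ℂ) * z + d) ≠ 0 := fun h0 => n2 ((map_eq_zero _).1 h0)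
  rw [map_div₀]
  have hd : (a : ℂ) * d - b * c = 1 := by exact_mod_cast hdet
  rw [div_sub_div _ _ n1 n3, div_left_inj' (mul_ne_zero n1 n3)]
  simp only [map_add, map_mul, Complex.conj_ofReal]
  linear_combination (z' - (starRingEnd ℂ) z) * hd

open Complex in
lemma mob_im (a b c d : ℝ) (hdet : a * d - b * c = 1) (z : ℂ) (hz : 0 < z.im) :
    (((a : ℂ) * z + b) / (c * z + d)).im = z.im / ‖(c : ℂ) * z + d‖ ^ 2 := by
  have h := mob_diff a b c d hdet z z hz hz
  rw [Complex.mul_conj', Complex.sub_conj, Complex.sub_conj] at h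
  have h2 : ((2 * (((a : ℂ) * z + b) / (c * z + d)).im : ℝ) : ℂ) * I =
      ((2 * z.im / ‖(c : ℂ) * z + d‖ ^ 2 : ℝ) : ℂ) * I := by
    rw [h]; push_cast; ring
  have h3 := mul_right_cancel₀ I_ne_zero h2
  have h4 : 2 * (((a : ℂ) * z + b) / (c * z + d)).im = 2 * z.im / ‖(c : ℂ) * z + d‖ ^ 2 := by
    exact_mod_cast h3
  have : 2 * z.im / ‖(c : ℂ) * z + d‖ ^ 2 = 2 * (z.im / ‖(c : ℂ) * z + d‖ ^ 2) := by ring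
  linarith

open Complex in
lemma chat_aux (a b c d : ℝ) (hdet : a * d - b * c = 1) (z' z : ℂ) (hz' : 0 < z'.im) (hz : 0 < z.im) :
    gammaK (((a : ℂ) * z' + b) / (c * z' + d)) (((a : ℂ) * z + b) / (c * z + d)) / gammaK z' z =
      Complex.exp ((arg ((z' - (starRingEnd ℂ) z) / (2 * I)) -
        arg ((((a : ℂ) * z' + b) / (c * z' + d) - (starRingEnd ℂ) (((a : ℂ) * z + b) / (c * z + d)))
          / (2 * I))) / 2 * I) := by
  have n1 := den_ne_s8 a b c d hdet z' hz'
  have n2 := den_ne_s8 a b c d hdet z hz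
  have i1 := mob_im a b c d hdet z' hz'
  have i2 := mob_im a b c d hdet z hz
  have m1 : 0 < ‖(c : ℂ) * z' + d‖ := norm_pos_iff.2 n1
  have m2 : 0 < ‖(c : ℂ) * z + d‖ := norm_pos_iff.2 n2
  have p1 : 0 < (((a : ℂ) * z' + b) / (c * z' + d)).im := by rw [i1]; positivity
  have p2 : 0 < (((a : ℂ) * z + b) / (c * z + d)).im := by rw [i2]; positivity
  rw [gammaK_eq _ _ p1 p2, gammaK_eq _ _ hz' hz, ← Complex.exp_sub]
  have hA := norm_pos_iff.2 (ne_of_re _ (re_pos_s8 z' z hz' hz))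
  have hl : Real.log ‖(((a : ℂ) * z' + b) / (c * z' + d) -
      (starRingEnd ℂ) (((a : ℂ) * z + b) / (c * z + d))) / (2 * I)‖ =
      Real.log ‖(z' - (starRingEnd ℂ) z) / (2 * I)‖ - Real.log ‖(c : ℂ) * z' + d‖
        - Real.log ‖(c : ℂ) * z + d‖ := by
    rw [mob_diff a b c d hdet z' z hz' hz, div_right_comm, norm_div, norm_mul, RCLike.norm_conj,
      Real.log_div hA.ne' (by positivity), Real.log_mul m1.ne' m2.ne']
    ring
  rw [hl, i1, i2, Real.log_div hz'.ne' (by positivity), Real.log_div hz.ne' (by positivity),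
    Real.log_pow, Real.log_pow]
  congr 1
  push_cast
  ring

open Complex in
lemma arg_main (a₁ b₁ c₁ d₁ a₂ b₂ c₂ d₂ : ℝ) (h₁ : a₁ * d₁ - b₁ * c₁ = 1)
    (h₂ : a₂ * d₂ - b₂ * c₂ = 1) (w : ℂ) (hw : w = ((a₂ : ℂ) * I + b₂) / (c₂ * I + d₂)) :
    arg ((I - (starRingEnd ℂ) w) / (2 * I)) -
        arg ((((a₁ : ℂ) * I + b₁) / (c₁ * I + d₁) - (starRingEnd ℂ) (((a₁ : ℂ) * w + b₁) / (c₁ * w + d₁)))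
          / (2 * I)) =
      Real.pi / 2 * (Real.sign c₁ * Real.sign c₂ * Real.sign (c₁ * a₂ + d₁ * c₂)) +
      arg (wv c₁ d₁) + arg (wv c₂ d₂) - arg (wv (c₁ * a₂ + d₁ * c₂) (c₁ * b₂ + d₁ * d₂)) := by
  have hI : 0 < I.im := by simp
  have hwim : 0 < w.im := by
    rw [hw, mob_im a₂ b₂ c₂ d₂ h₂ I hI]
    have := norm_pos_iff.2 (den_ne_s8 a₂ b₂ c₂ d₂ h₂ I hI)
    positivity
  have hA := re_pos_s8 I w hI hwim
  have n1 := den_ne_s8 a₁ b₁ c₁ d₁ h₁ I hI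
  have nJ := den_ne_s8 a₁ b₁ c₁ d₁ h₁ w hwim
  have n2 := den_ne_s8 a₂ b₂ c₂ d₂ h₂ I hI
  have hB := re_pos_s8 (((a₁ : ℂ) * I + b₁) / (c₁ * I + d₁)) (((a₁ : ℂ) * w + b₁) / (c₁ * w + d₁))
    (by rw [mob_im a₁ b₁ c₁ d₁ h₁ I hI]
        have := norm_pos_iff.2 n1
        positivity)
    (by rw [mob_im a₁ b₁ c₁ d₁ h₁ w hwim]
        have := norm_pos_iff.2 nJ
        positivity)
  rw [mob_diff a₁ b₁ c₁ d₁ h₁ I w hI hwim, div_right_comm] at hB ⊢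
  set A := (I - (starRingEnd ℂ) w) / (2 * I) with hAdef
  have hJ : ((c₁ : ℂ) * w + d₁) * (c₂ * I + d₂) =
      ((c₁ * a₂ + d₁ * c₂ : ℝ) : ℂ) * I + ((c₁ * b₂ + d₁ * d₂ : ℝ) : ℂ) := by
    have hwj : w * ((c₂ : ℂ) * I + d₂) = a₂ * I + b₂ := by rw [hw, div_mul_cancel₀ _ n2]
    push_cast
    linear_combination (c₁ : ℂ) * hwj
  have hdet3 : (c₁ * a₂ + d₁ * c₂) * d₂ - (c₁ * b₂ + d₁ * d₂) * c₂ = c₁ := by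
    linear_combination c₁ * h₂
  by_cases hc1 : c₁ = 0
  · subst hc1
    have hd1 : d₁ ≠ 0 := by rintro rfl; simp at h₁
    have e1 : A / (((0 : ℝ) : ℂ) * I + d₁) / (starRingEnd ℂ) (((0 : ℝ) : ℂ) * w + d₁) =
        ((1 / d₁ ^ 2 : ℝ) : ℂ) * A := by
      have : (d₁ : ℂ) ≠ 0 := by exact_mod_cast hd1
      simp
      field_simp
    have e1' : A / ((((0 : ℝ) : ℂ) * I + d₁) * (starRingEnd ℂ) (((0 : ℝ) : ℂ) * w + d₁)) =
        ((1 / d₁ ^ 2 : ℝ) : ℂ) * A := by rw [← div_div, e1]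
    rw [e1', Complex.arg_real_mul _ (by positivity)]
    have : arg (wv (0 * a₂ + d₁ * c₂) (0 * b₂ + d₁ * d₂)) = arg (wv c₂ d₂) := by
      by_cases hc2 : c₂ = 0
      · simp [wv, hc2]
      · have hs := sign_cases d₁ hd1
        have : wv (0 * a₂ + d₁ * c₂) (0 * b₂ + d₁ * d₂) = ((Real.sign d₁ * d₁ : ℝ) : ℂ) * wv c₂ d₂ := by
          have hsm : Real.sign (d₁ * c₂) = Real.sign d₁ * Real.sign c₂ := by
            rcases lt_or_gt_of_ne hd1 with h | h <;> rcases lt_or_gt_of_ne hc2 with h' | h'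
            · rw [Real.sign_of_neg h, Real.sign_of_neg h', Real.sign_of_pos (mul_pos_of_neg_of_neg h h')]; simp
            · rw [Real.sign_of_neg h, Real.sign_of_pos h', Real.sign_of_neg (mul_neg_of_neg_of_pos h h')]; simp
            · rw [Real.sign_of_pos h, Real.sign_of_neg h', Real.sign_of_neg (mul_neg_of_pos_of_neg h h')]; simp
            · rw [Real.sign_of_pos h, Real.sign_of_pos h', Real.sign_of_pos (mul_pos h h')]; simp
          unfold wv
          rw [if_neg (by simp [hd1, hc2]), if_neg hc2]
          simp only [zero_mul, zero_add, hsm]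
          push_cast; ring
        rw [this, Complex.arg_real_mul _ hs.2]
    rw [this]
    simp [wv]
  have s1 := sign_cases c₁ hc1
  have w1 := wv_ne c₁ d₁ hc1
  have w1re := wv_re c₁ d₁
  set P : ℂ := (Real.sign c₁ : ℂ) * (-I) * (c₁ * w + d₁) with hP
  have Pre : 0 < P.re := by
    have : P.re = Real.sign c₁ * c₁ * w.im := by
      rw [hP]
      simp [Complex.mul_re, Complex.mul_im]
      ring
    rw [this]; exact mul_pos s1.2 hwim
  have ss : (Real.sign c₁ : ℂ) * (Real.sign c₁ : ℂ) = 1 := by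
    rcases s1.1 with h | h <;> rw [h] <;> simp
  have F := four_arg A _ (wv c₁ d₁) P hA hB w1re Pre (by
    rw [w1, hP]
    have nJ' : (starRingEnd ℂ) ((c₁ : ℂ) * w + d₁) ≠ 0 := fun h0 => nJ ((map_eq_zero _).1 h0)
    rw [map_mul, map_mul, map_neg, Complex.conj_I, Complex.conj_ofReal]
    field_simp
    linear_combination (-A) * ss + (A * (Real.sign c₁ : ℂ) ^ 2) * I_sq)
  rw [F]
  set c₃ := c₁ * a₂ + d₁ * c₂ with hc3def
  set d₃ := c₁ * b₂ + d₁ * d₂ with hd3def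
  have hPj : P * (c₂ * I + d₂) = (Real.sign c₁ : ℂ) * (-I) * (c₃ * I + d₃) := by
    rw [hP, ← hJ]; ring
  by_cases hc2 : c₂ = 0
  · have hd2 : d₂ ≠ 0 := by
      rintro rfl
      rw [hc2] at h₂; simp at h₂
    have hc3 : c₃ ≠ 0 := by
      intro h; rw [h, hc2] at hdet3; apply hc1; linarith
    have e : P * ((Real.sign c₁ * Real.sign c₃ * d₂ : ℝ) : ℂ) = wv c₃ d₃ := by
      rw [wv_ne _ _ hc3]
      rw [hc2] at hPj
      simp only [ofReal_zero, zero_mul, zero_add] at hPj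
      push_cast
      linear_combination ((Real.sign c₁ : ℂ) * (Real.sign c₃ : ℂ)) * hPj +
        (Real.sign c₃ : ℂ) * (-I) * (c₃ * I + d₃) * ss
    have epos : 0 < Real.sign c₁ * Real.sign c₃ * d₂ := by
      have h3 : c₃ * d₂ = c₁ := by rw [hc2] at hdet3; linarith
      have s3 := sign_cases c₃ hc3
      have x1 : 0 < Real.sign c₁ * (c₃ * d₂) := by rw [h3]; exact s1.2
      have x2 : 0 < (Real.sign c₁ * (c₃ * d₂)) * (Real.sign c₃ * c₃) := mul_pos x1 s3.2
      have x3 : (Real.sign c₁ * (c₃ * d₂)) * (Real.sign c₃ * c₃) =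
        (Real.sign c₁ * Real.sign c₃ * d₂) * c₃ ^ 2 := by ring
      rw [x3] at x2
      exact pos_of_mul_pos_left x2 (sq_nonneg _)
    rw [← e, mul_comm P, Complex.arg_real_mul _ epos, hc2]
    simp [wv]
  by_cases hc3 : c₃ = 0
  · have e : P * wv c₂ d₂ = ((-(Real.sign c₁ * Real.sign c₂ * d₃) : ℝ) : ℂ) := by
      rw [wv_ne _ _ hc2]
      rw [hc3] at hPj
      push_cast
      simp only [ofReal_zero, zero_mul, zero_add] at hPj
      linear_combination ((Real.sign c₂ : ℂ) * (-I)) * hPj +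
        (Real.sign c₁ : ℂ) * (Real.sign c₂ : ℂ) * d₃ * I_sq
    have epos : 0 < -(Real.sign c₁ * Real.sign c₂ * d₃) := by
      have h3 : -(d₃ * c₂) = c₁ := by rw [hc3] at hdet3; linarith
      have s2 := sign_cases c₂ hc2
      have x1 : 0 < Real.sign c₁ * (-(d₃ * c₂)) := by rw [h3]; exact s1.2
      have x2 : 0 < (Real.sign c₁ * (-(d₃ * c₂))) * (Real.sign c₂ * c₂) := mul_pos x1 s2.2
      have x3 : (Real.sign c₁ * (-(d₃ * c₂))) * (Real.sign c₂ * c₂) =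
        (-(Real.sign c₁ * Real.sign c₂ * d₃)) * c₂ ^ 2 := by ring
      rw [x3] at x2
      exact pos_of_mul_pos_left x2 (sq_nonneg _)
    have w2re := wv_re c₂ d₂
    have key : arg P = -arg (wv c₂ d₂) := by
      apply arg_unique
      · push_cast
        rw [neg_mul, Complex.exp_neg, exp_arg _ (ne_of_re _ Pre), exp_arg _ (ne_of_re _ w2re)]
        have nP : (‖P‖ : ℂ) ≠ 0 := by exact_mod_cast norm_ne_zero_iff.2 (ne_of_re _ Pre)
        have nw : (‖wv c₂ d₂‖ : ℂ) ≠ 0 := by exact_mod_cast norm_ne_zero_iff.2 (ne_of_re _ w2re)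
        have zw := ne_of_re _ w2re
        have hn : ‖P‖ * ‖wv c₂ d₂‖ = -(Real.sign c₁ * Real.sign c₂ * d₃) := by
          rw [← norm_mul, e, Complex.norm_real, Real.norm_eq_abs, abs_of_pos epos]
        have hn' : P * wv c₂ d₂ = ‖P‖ * ‖wv c₂ d₂‖ := by
          rw [e, ← hn]; push_cast; ring
        field_simp
        linear_combination hn'
      · have a := arg_bd _ Pre
        have b := arg_bd _ w2re
        rw [abs_lt]; constructor <;> linarith
    rw [key, hc3]
    simp [wv]
  · have s2 := sign_cases c₂ hc2
    have s3 := sign_cases c₃ hc3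
    have ss2 : (Real.sign c₂ : ℂ) * (Real.sign c₂ : ℂ) = 1 := by
      rcases s2.1 with h | h <;> rw [h] <;> simp
    have ss3 : (Real.sign c₃ : ℂ) * (Real.sign c₃ : ℂ) = 1 := by
      rcases s3.1 with h | h <;> rw [h] <;> simp
    have hs : Real.sign c₁ * Real.sign c₂ * Real.sign c₃ = 1 ∨
        Real.sign c₁ * Real.sign c₂ * Real.sign c₃ = -1 := by
      rcases s1.1 with h | h <;> rcases s2.1 with h' | h' <;> rcases s3.1 with h'' | h'' <;>
        rw [h, h', h''] <;> simp
    have R := rot_arg P (wv c₃ d₃) (wv c₂ d₂) _ hs Pre (wv_re _ _) (wv_re _ _) (by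
      rw [wv_ne _ _ hc2, wv_ne _ _ hc3]
      push_cast
      linear_combination ((Real.sign c₂ : ℂ) * (-I)) * hPj -
        (Real.sign c₁ : ℂ) * (Real.sign c₂ : ℂ) * (-I) * (-I) * (c₃ * I + d₃) * ss3)
    rw [R]; ring

open Complex in
lemma part2 (g₁ g₂ : Matrix (Fin 2) (Fin 2) ℤ) (h₁ : g₁.det = 1) (h₂ : g₂.det = 1) :
    chat (toR g₁) (toR g₂) = (bhat1 g₁)⁻¹ * (bhat1 g₂)⁻¹ * bhat1 (g₁ * g₂) := by
  have p1 := part1 g₁ g₂ h₁ h₂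
  have h₃ : (g₁ * g₂).det = 1 := by rw [Matrix.det_mul, h₁, h₂, mul_one]
  rw [bhat_eq _ h₁, bhat_eq _ h₂, bhat_eq _ h₃]
  have r1 : ((g₁ 0 0 : ℤ) : ℝ) * (g₁ 1 1 : ℤ) - (g₁ 0 1 : ℤ) * (g₁ 1 0 : ℤ) = 1 := by
    rw [Matrix.det_fin_two] at h₁; exact_mod_cast h₁
  have r2 : ((g₂ 0 0 : ℤ) : ℝ) * (g₂ 1 1 : ℤ) - (g₂ 0 1 : ℤ) * (g₂ 1 0 : ℤ) = 1 := by
    rw [Matrix.det_fin_two] at h₂; exact_mod_cast h₂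
  have hI : 0 < I.im := by simp
  have n2 := den_ne_s8 _ _ _ _ r2 I hI
  set w : ℂ := mobius (toR g₂) I with hw
  have hw' : w = ((((g₂ 0 0 : ℤ) : ℝ) : ℂ) * I + (((g₂ 0 1 : ℤ) : ℝ) : ℂ)) /
      ((((g₂ 1 0 : ℤ) : ℝ) : ℂ) * I + (((g₂ 1 1 : ℤ) : ℝ) : ℂ)) := by
    rw [hw]; rfl
  have hwim : 0 < w.im := by
    rw [hw', mob_im _ _ _ _ r2 I hI]
    have := norm_pos_iff.2 n2
    positivity
  have nJ := den_ne_s8 _ _ _ _ r1 w hwim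
  have hcomp : mobius (toR g₁ * toR g₂) I = ((((g₁ 0 0 : ℤ) : ℝ) : ℂ) * w + (((g₁ 0 1 : ℤ) : ℝ) : ℂ)) /
      ((((g₁ 1 0 : ℤ) : ℝ) : ℂ) * w + (((g₁ 1 1 : ℤ) : ℝ) : ℂ)) := by
    have t : ∀ x y : ℝ, (x : ℂ) * w + y = (x * ((((g₂ 0 0 : ℤ) : ℝ) : ℂ) * I + (((g₂ 0 1 : ℤ) : ℝ) : ℂ)) +
      y * ((((g₂ 1 0 : ℤ) : ℝ) : ℂ) * I + (((g₂ 1 1 : ℤ) : ℝ) : ℂ))) /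
      ((((g₂ 1 0 : ℤ) : ℝ) : ℂ) * I + (((g₂ 1 1 : ℤ) : ℝ) : ℂ)) := by
      intro x y
      rw [hw', eq_div_iff n2, add_mul, mul_assoc, div_mul_cancel₀ _ n2]
    rw [t, t, div_div_div_cancel_right₀ n2]
    unfold mobius toR
    simp only [Matrix.mul_apply, Fin.sum_univ_two, Matrix.map_apply]
    push_cast
    congr 1 <;> ring
  have C := chat_aux _ _ _ _ r1 I w hI hwim
  have M := arg_main _ _ _ _ _ _ _ _ r1 r2 w hw'
  unfold chat
  rw [hcomp]
  refine Eq.trans C ?_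
  rw [← Complex.ofReal_sub, M]
  have c3 : (((g₁ * g₂) 1 0 : ℤ) : ℝ) = (g₁ 1 0 : ℤ) * (g₂ 0 0 : ℤ) + (g₁ 1 1 : ℤ) * (g₂ 1 0 : ℤ) := by
    simp [Matrix.mul_apply, Fin.sum_univ_two]
  have d3 : (((g₁ * g₂) 1 1 : ℤ) : ℝ) = (g₁ 1 0 : ℤ) * (g₂ 0 1 : ℤ) + (g₁ 1 1 : ℤ) * (g₂ 1 1 : ℤ) := by
    simp [Matrix.mul_apply, Fin.sum_univ_two]
  rw [← c3, ← d3]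
  simp only [mul_inv, ← Complex.exp_neg]
  have fin : ∀ x y z p q r : ℂ, x * p * (y * q) * (z * r) = (x * y * z) * (p * q * r) := by
    intros; ring
  rw [fin, ← p1, ← Complex.exp_add, ← Complex.exp_add, ← Complex.exp_add]
  congr 1
  rw [Int.sign_mul, Int.sign_mul, real_sign_cast, real_sign_cast, real_sign_cast]
  push_cast
  ring

theorem statement8 (g₁ g₂ : Matrix (Fin 2) (Fin 2) ℤ) (h₁ : g₁.det = 1) (h₂ : g₂.det = 1) :
    Complex.exp (Complex.I * (Real.pi : ℂ) / 4 *
        (Int.sign (g₁ 1 0 * g₂ 1 0 * (g₁ * g₂) 1 0) : ℂ)) =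
      (btilde1 g₁)⁻¹ * (btilde1 g₂)⁻¹ * btilde1 (g₁ * g₂) ∧
    chat (toR g₁) (toR g₂) = (bhat1 g₁)⁻¹ * (bhat1 g₂)⁻¹ * bhat1 (g₁ * g₂) := by
  
  exact ⟨part1 g₁ g₂ h₁ h₂, part2 g₁ g₂ h₁ h₂⟩
end
end

section
/- Let c and d be coprime nonzero integers with cd even, and let G(d,c) := |c|^{−1/2} · Σ_{n=0}^{|c|−1} e^{−πi·d·n²/c}. Then: if c = 2c' and |d| ≡ 1 (mod 4), G(d,c) = (c'/|d|)·e^{−(iπ/4)·sgn(cd)}; if c = 2c' and |d| ≡ 3 (mod 4), G(d,c) = i·sgn(d)·(c'/|d|)·e^{−(iπ/4)·sgn(cd)}; if d = 2d' and |c| ≡ 1 (mod 4), G(d,c) = (d'/|c|); and if d = 2d' and |c| ≡ 3 (mod 4), G(d,c) = −i·sgn(c)·(d'/|c|). -/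
noncomputable section

/-- The symplectic Gauss sum `G(d, c)`. -/
def gaussG (d c : ℤ) : ℂ :=
  (((c.natAbs : ℝ) ^ (-(1 : ℝ) / 2) : ℝ) : ℂ) *
    ∑ n ∈ Finset.range c.natAbs,
      Complex.exp (-(Real.pi : ℂ) * Complex.I * (d : ℂ) * (n : ℂ) ^ 2 / (c : ℂ))

namespace GS
open Complex Filter Topology

noncomputable def KK (q : ℕ) (r : ℕ) (w : ℂ) : ℂ :=
  ∑' n : ℤ, cexp (-Real.pi * w * n ^ 2 / q ^ 2 + 2 * Real.pi * I * n * r / q)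

noncomputable def SS (p : ℤ) (q : ℕ) : ℂ :=
  ∑ r ∈ Finset.range q, cexp (-(Real.pi : ℂ) * I * p * (r : ℂ) ^ 2 / q)

lemma summ_bound : Summable (fun n : ℤ => Real.exp (-Real.pi * n ^ 2)) := by
  have := summable_pow_mul_jacobiTheta₂_term_bound 0 (zero_lt_one) 0
  simpa using this

lemma summ_gauss {a : ℂ} (ha : 0 < a.re) :
    Summable (fun n : ℤ => cexp (-Real.pi * a * n ^ 2)) := by
  have := (summable_jacobiTheta₂_term_iff 0 (I * a)).2 (by simpa using ha)
  refine this.congr fun n => ?_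
  simp only [jacobiTheta₂_term]
  congr 1
  linear_combination (Real.pi * n ^ 2 * a : ℂ) * I_mul_I

lemma KK_tendsto {ι : Type*} {l : Filter ι} (q r : ℕ) (hq : 0 < q) (w : ι → ℂ)
    (hw : Tendsto (fun i => (w i).re) l atTop) :
    Tendsto (fun i => KK q r (w i)) l (𝓝 1) := by
  have hq' : (0 : ℝ) < q := by exact_mod_cast hq
  have hnorm : ∀ (i : ι) (n : ℤ), ‖cexp (-Real.pi * w i * n ^ 2 / q ^ 2 + 2 * Real.pi * I * n * r / q)‖
      = Real.exp (-Real.pi * (n : ℝ) ^ 2 / q ^ 2 * (w i).re) := by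
    intro i n
    rw [Complex.norm_exp]
    congr 1
    have : (-Real.pi * w i * n ^ 2 / q ^ 2 + 2 * Real.pi * I * n * r / q : ℂ)
      = ((-Real.pi * (n : ℝ) ^ 2 / q ^ 2 : ℝ) : ℂ) * w i + ((2 * Real.pi * n * r / q : ℝ) : ℂ) * I := by
      push_cast; ring
    rw [this]
    simp only [add_re, re_ofReal_mul, I_re, mul_zero, add_zero]
  have h1 : (1 : ℂ) = ∑' n : ℤ, (if n = 0 then (1 : ℂ) else 0) := by
    rw [tsum_ite_eq]
  rw [h1]
  refine tendsto_tsum_of_dominated_convergence summ_bound ?_ ?_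
  · intro n
    by_cases hn : n = 0
    · subst hn; simp [tendsto_const_nhds]
    · rw [if_neg hn, tendsto_zero_iff_norm_tendsto_zero]
      simp_rw [hnorm]
      refine Real.tendsto_exp_atBot.comp ?_
      refine Tendsto.const_mul_atTop_of_neg ?_ hw
      have : (0 : ℝ) < (n : ℝ) ^ 2 := by positivity
      have := Real.pi_pos
      rw [neg_mul, neg_div]
      apply neg_neg_of_pos
      positivity
  · filter_upwards [hw.eventually_ge_atTop ((q : ℝ) ^ 2)] with i hi n
    rw [hnorm, Real.exp_le_exp]
    have h2 : (0 : ℝ) ≤ Real.pi * (n : ℝ) ^ 2 / q ^ 2 := by positivity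
    have := mul_le_mul_of_nonneg_left hi h2
    rw [div_mul_cancel₀ _ (by positivity)] at this
    calc _ = -(Real.pi * (n : ℝ) ^ 2 / q ^ 2 * (w i).re) := by ring
      _ ≤ _ := by linarith

lemma H_eq (q r : ℕ) (hq : 0 < q) {δ : ℂ} (hδ : 0 < δ.re) :
    ∑' m : ℤ, cexp (-Real.pi * δ * ((m * q + r : ℂ)) ^ 2) =
      1 / (δ * q ^ 2) ^ (1 / 2 : ℂ) * KK q r (1 / δ) := by
  have hq0 : (q : ℂ) ≠ 0 := by exact_mod_cast hq.ne'
  have hδ0 : δ ≠ 0 := by rintro rfl; simp at hδ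
  have hre : 0 < (δ * q ^ 2).re := by
    have : (δ * q ^ 2) = ((q ^ 2 : ℝ) : ℂ) * δ := by push_cast; ring
    rw [this, re_ofReal_mul]; positivity
  have h := Complex.tsum_exp_neg_quadratic hre (-δ * q * r)
  have e1 : ∀ m : ℤ, cexp (-Real.pi * δ * ((m * q + r : ℂ)) ^ 2) =
      cexp (-Real.pi * δ * r ^ 2) *
        cexp (-Real.pi * (δ * q ^ 2) * m ^ 2 + 2 * Real.pi * (-δ * q * r) * m) := by
    intro m; rw [← Complex.exp_add]; congr 1; ring
  simp_rw [e1]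
  rw [tsum_mul_left, h, KK, mul_left_comm, ← tsum_mul_left]
  congr 2
  ext n
  rw [← Complex.exp_add]; congr 1
  field_simp
  have := I_sq
  linear_combination (-(q : ℂ) ^ 2 * δ ^ 2 * r ^ 2 : ℂ) * I_sq

lemma theta_split (p : ℤ) (q : ℕ) (hq : 0 < q) (hpq : Even (p * q)) {δ : ℂ} (hδ : 0 < δ.re) :
    ∑' n : ℤ, cexp (-Real.pi * (δ + I * p / q) * n ^ 2) =
      1 / (δ * q ^ 2) ^ (1 / 2 : ℂ) * ∑ r ∈ Finset.range q,
        cexp (-(Real.pi : ℂ) * I * p * (r : ℂ) ^ 2 / q) * KK q r (1 / δ) := by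
  have hq0 : (q : ℂ) ≠ 0 := by exact_mod_cast hq.ne'
  have : NeZero q := ⟨hq.ne'⟩
  have hs : Summable (fun n : ℤ => cexp (-Real.pi * (δ + I * p / q) * n ^ 2)) := by
    apply summ_gauss
    have : (I * p / q : ℂ) = ((p / q : ℝ) : ℂ) * I := by push_cast; ring
    rw [this]
    simpa using hδ
  have hs' := (Int.divModEquiv q).symm.summable_iff.2 hs
  rw [← (Int.divModEquiv q).symm.tsum_eq]
  have hs2 := (Equiv.prodComm (Fin q) ℤ).summable_iff.2 hs'
  rw [← (Equiv.prodComm (Fin q) ℤ).tsum_eq]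
  erw [hs2.tsum_prod]
  rw [tsum_fintype, Finset.mul_sum, Finset.sum_range]
  refine Finset.sum_congr rfl fun r _ => ?_
  rw [mul_left_comm, ← H_eq q r hq hδ, ← tsum_mul_left]
  refine tsum_congr fun m => ?_
  simp only [Function.comp, Equiv.prodComm_apply, Prod.swap, Int.divModEquiv_symm_apply]
  rw [← Complex.exp_add, Complex.exp_eq_exp_iff_exists_int]
  obtain ⟨k, hk⟩ := hpq
  refine ⟨-(k * m ^ 2 + p * m * r), ?_⟩
  have hk' : (p * q : ℂ) = k + k := by exact_mod_cast hk
  push_cast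
  field_simp
  linear_combination (-(m:ℂ)^2 * I * q) * hk'

lemma LS (p q : ℕ) (hp : 0 < p) (hq : 0 < q) (hpq : Even (p * q)) :
    SS p q = cexp (-(I * Real.pi / 4)) * ((q : ℝ) ^ (1 / 2 : ℝ) : ℝ) / ((p : ℝ) ^ (1 / 2 : ℝ) : ℝ)
      * SS (-q) p := by
  have hq' : (0 : ℝ) < q := by exact_mod_cast hq
  have hp' : (0 : ℝ) < p := by exact_mod_cast hp
  have hq0 : (q : ℂ) ≠ 0 := by exact_mod_cast hq.ne'
  have hp0 : (p : ℂ) ≠ 0 := by exact_mod_cast hp.ne'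
  set C : ℂ := cexp (-(I * Real.pi / 4)) * ((q : ℝ) ^ (1 / 2 : ℝ) : ℝ) / ((p : ℝ) ^ (1 / 2 : ℝ) : ℝ) with hC
  let w : ℝ → ℂ := fun ε => ((p ^ 2 / q ^ 2 * ε⁻¹ : ℝ) : ℂ) - ((p / q : ℝ) : ℂ) * I
  have hwre : ∀ ε, (w ε).re = p ^ 2 / q ^ 2 * ε⁻¹ := by
    intro ε
    have : w ε = ((p ^ 2 / q ^ 2 * ε⁻¹ : ℝ) : ℂ) - ((p / q : ℝ) : ℂ) * I := rfl
    rw [this, sub_re, re_ofReal_mul, ofReal_re, I_re]; ring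
  let F : ℝ → ℂ := fun ε => ∑ r ∈ Finset.range q,
        cexp (-(Real.pi : ℂ) * I * (p : ℤ) * (r : ℂ) ^ 2 / q) * KK q r (1 / (ε : ℂ))
  let F' : ℝ → ℂ := fun ε => ∑ r ∈ Finset.range p,
        cexp (-(Real.pi : ℂ) * I * (-q : ℤ) * (r : ℂ) ^ 2 / p) * KK p r (w ε)
  have hF : Tendsto F (𝓝[>] 0) (𝓝 (SS p q)) := by
    refine tendsto_finsetSum _ fun r _ => ?_
    rw [← mul_one (cexp _)]
    simp only [mul_one]
    conv => arg 3; rw [← mul_one (cexp _)]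
    refine Tendsto.const_mul _ (KK_tendsto q r hq _ ?_)
    have : ∀ ε : ℝ, (1 / (ε : ℂ)).re = ε⁻¹ := by
      intro ε; rw [one_div, ← ofReal_inv, ofReal_re]
    simp_rw [this]
    exact tendsto_inv_nhdsGT_zero
  have hF' : Tendsto F' (𝓝[>] 0) (𝓝 (SS (-q) p)) := by
    refine tendsto_finsetSum _ fun r _ => ?_
    conv => arg 3; rw [← mul_one (cexp _)]
    refine Tendsto.const_mul _ (KK_tendsto p r hp _ ?_)
    simp_rw [hwre]
    exact Tendsto.const_mul_atTop (by positivity) tendsto_inv_nhdsGT_zero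
  have key : ∀ ε : ℝ, 0 < ε → F ε = C * F' ε := by
    intro ε hε
    have hε0 : (ε : ℂ) ≠ 0 := by exact_mod_cast hε.ne'
    set a : ℂ := ε + I * (p : ℤ) / q with ha
    have hare : 0 < a.re := by
      have : a = ε + ((p / q : ℝ) : ℂ) * I := by rw [ha]; push_cast; ring
      rw [this]; simpa using hε
    have ha0 : a ≠ 0 := by intro h; rw [h] at hare; simp at hare
    have hw0 : w ε ≠ 0 := by
      intro h
      have := hwre ε
      rw [h] at this
      have : 0 < p ^ 2 / q ^ 2 * ε⁻¹ := by positivity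
      simp_all
    set δ : ℂ := 1 / w ε with hδ
    have hδre : 0 < δ.re := by
      rw [hδ, one_div, Complex.inv_re]
      have : 0 < (w ε).re := by rw [hwre]; positivity
      have := Complex.normSq_pos.2 hw0
      positivity
    have hδ0 : δ ≠ 0 := by intro h; rw [h] at hδre; simp at hδre
    have hwa : w ε = p * a / (I * q * ε) := by
      have : w ε = ((p ^ 2 / q ^ 2 * ε⁻¹ : ℝ) : ℂ) - ((p / q : ℝ) : ℂ) * I := rfl
      rw [this, ha]; push_cast
      field_simp
      linear_combination (-(q : ℂ) * ε) * I_sq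
    have hinv : 1 / a = δ + I * (-q : ℤ) / p := by
      have e : (q : ℂ) * a = q * ε + I * p := by rw [ha]; push_cast; field_simp
      rw [hδ, hwa]
      push_cast
      clear_value a
      field_simp
      linear_combination I * e + p * I_sq
    have t1 := theta_split p q hq (by exact_mod_cast hpq) (δ := ε) (by simpa using hε)
    have t2 := theta_split (-q) p hp (by rw [neg_mul]; refine Even.neg ?_; rw [mul_comm]; exact_mod_cast hpq) hδre
    have t3 := Complex.tsum_exp_neg_mul_int_sq hare
    rw [← ha] at t1
    rw [← hinv] at t2
    rw [t1] at t3
    have e3 : ∀ n : ℤ, cexp (-Real.pi / a * (n : ℂ) ^ 2) = cexp (-Real.pi * (1 / a) * (n : ℂ) ^ 2) := by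
      intro n; congr 1; ring
    simp_rw [e3] at t3
    rw [t2] at t3
    have hww : 1 / δ = w ε := by rw [hδ, one_div_one_div]
    rw [hww] at t3
    change _ * F ε = _ * (_ * F' ε) at t3
    have hre2 : 0 < (δ * p ^ 2).re := by
      have : (δ * p ^ 2) = ((p ^ 2 : ℝ) : ℂ) * δ := by push_cast; ring
      rw [this, re_ofReal_mul]; positivity
    have hd0 : δ * (p : ℂ) ^ 2 ≠ 0 := by intro h; rw [h] at hre2; simp at hre2
    have hq20 : (ε : ℂ) * (q : ℂ) ^ 2 ≠ 0 := by positivity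
    have hprod : a * (δ * p ^ 2) = ((ε * p * q : ℝ) : ℂ) * I := by
      rw [hδ, hwa]; push_cast
      clear_value a
      field_simp
    have b1 := abs_lt.1 (Complex.abs_arg_lt_pi_div_two_iff.2 (Or.inl hare))
    have b2 := abs_lt.1 (Complex.abs_arg_lt_pi_div_two_iff.2 (Or.inl hre2))
    have hlog := (Complex.log_mul_eq_add_log_iff ha0 hd0).2 ⟨by linarith, by linarith⟩
    rw [hprod, Complex.log_ofReal_mul (by positivity) I_ne_zero, Complex.log_I,
      Real.log_mul (by positivity) (by positivity), Real.log_mul (by positivity) (by positivity)] at hlog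
    have hlog2 : Complex.log ((ε : ℂ) * (q : ℂ) ^ 2) = (Real.log ε + 2 * Real.log q : ℝ) := by
      rw [show (ε : ℂ) * (q : ℂ) ^ 2 = ((ε * q ^ 2 : ℝ) : ℂ) by push_cast; ring,
        ← Complex.ofReal_log (by positivity), Real.log_mul (by positivity) (by positivity), Real.log_pow]
      push_cast; rfl
    rw [cpow_def_of_ne_zero hq20, cpow_def_of_ne_zero ha0, cpow_def_of_ne_zero hd0, hlog2] at t3
    simp only [one_div] at t3
    rw [← Complex.exp_neg, ← Complex.exp_neg, ← Complex.exp_neg,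
      ← mul_assoc, ← Complex.exp_add] at t3
    have hCe : C = cexp (-(I * Real.pi / 4) + Real.log q / 2 - Real.log p / 2) := by
      rw [hC, Real.rpow_def_of_pos hq', Real.rpow_def_of_pos hp', Complex.exp_sub, Complex.exp_add]
      push_cast
      congr 3 <;> ring
    rw [hCe]
    have hne := Complex.exp_ne_zero (-(((Real.log ε + 2 * Real.log q : ℝ) : ℂ) * 2⁻¹))
    apply mul_left_cancel₀ hne
    rw [t3, ← mul_assoc, ← Complex.exp_add]
    congr 2
    push_cast at hlog ⊢
    linear_combination (1 / 2 : ℂ) * hlog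
  refine tendsto_nhds_unique (hF.congr' ?_) (hF'.const_mul C)
  filter_upwards [self_mem_nhdsWithin] with ε hε using key ε hε

end GS

namespace GS
open Complex ComplexConjugate NumberTheorySymbols

noncomputable def GG (p : ℤ) (q : ℕ) : ℂ := (((q : ℝ) ^ (-(1 : ℝ) / 2) : ℝ) : ℂ) * SS p q

noncomputable def zz : ℂ := cexp (-(I * Real.pi / 4))

lemma zz_sq : zz * zz = -I := by
  rw [zz, ← Complex.exp_add, show -(I * Real.pi / 4) + -(I * Real.pi / 4) = -(Real.pi / 2 * I) by ring,
    Complex.exp_neg, Complex.exp_pi_div_two_mul_I, Complex.inv_I]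

lemma zz_conj : conj zz = cexp (I * Real.pi / 4) := by
  rw [zz, ← Complex.exp_conj]
  congr 1
  simp [Complex.conj_ofNat]
  ring

lemma zz_mul_conj : zz * conj zz = 1 := by
  rw [zz_conj, zz, ← Complex.exp_add]; simp

lemma GG_swap (p q : ℕ) (hp : 0 < p) (hq : 0 < q) (hpq : Even (p * q)) :
    GG p q = zz * GG (-q) p := by
  have hq' : (0 : ℝ) < q := by exact_mod_cast hq
  have hp' : (0 : ℝ) < p := by exact_mod_cast hp
  have h1 : (((q : ℝ) ^ (1 / 2 : ℝ) : ℝ) : ℂ) ≠ 0 := by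
    exact_mod_cast (Real.rpow_pos_of_pos hq' _).ne'
  have h2 : (((p : ℝ) ^ (1 / 2 : ℝ) : ℝ) : ℂ) ≠ 0 := by
    exact_mod_cast (Real.rpow_pos_of_pos hp' _).ne'
  rw [GG, GG, LS p q hp hq hpq, zz, neg_div, Real.rpow_neg hq'.le, Real.rpow_neg hp'.le]
  rw [ofReal_inv, ofReal_inv]
  field_simp

lemma GG_conj (p : ℤ) (q : ℕ) : GG (-p) q = conj (GG p q) := by
  rw [GG, GG, map_mul, conj_ofReal, SS, SS, map_sum]
  congr 1
  refine Finset.sum_congr rfl fun r _ => ?_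
  rw [← Complex.exp_conj]
  congr 1
  simp [map_div₀]

lemma GG_per (p k : ℤ) (q : ℕ) : GG (p + 2 * q * k) q = GG p q := by
  rw [GG, GG, SS, SS]
  congr 1
  refine Finset.sum_congr rfl fun r hr => ?_
  have hq : (q : ℂ) ≠ 0 := by
    have := Finset.mem_range.1 hr
    exact_mod_cast (by omega : q ≠ 0)
  rw [Complex.exp_eq_exp_iff_exists_int]
  refine ⟨-(k * r ^ 2), ?_⟩
  push_cast
  field_simp
  ring

lemma GG_one (p : ℤ) : GG p 1 = 1 := by
  simp [GG, SS]

noncomputable def EE (n : ℕ) : ℂ := if n % 4 = 1 then 1 else -I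

lemma J_neg_eq (b n m : ℕ) (hb : 0 < b) (hn : Odd n) (hm : Odd m) (h : n % (4 * b) + m = 4 * b) :
    J(b | n) = J(b | m) := by
  have hodd : Odd (4 * b - 1) := by rw [Nat.odd_iff]; omega
  have h1 : J(b | 4 * b - 1) = 1 := by
    have h4 := jacobiSym.at_four hodd
    have : J((4 : ℤ) * b | 4 * b - 1) = J(1 | 4 * b - 1) := by
      apply jacobiSym.mod_left'
      rw [Nat.cast_sub (by omega)]
      push_cast
      have h := Int.add_emod_right 1 (4 * b - 1 : ℤ)
      rwa [show (1 + (4 * b - 1) : ℤ) = 4 * b by ring] at h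
    rw [jacobiSym.mul_left, h4, one_mul, jacobiSym.one_left] at this
    exact this
  have hn0 : n ≠ 0 := by rintro rfl; simp at hn
  have h2 := jacobiSym.mul_right' (b : ℤ) (b₁ := m) (b₂ := 4 * b - 1)
    (by rintro rfl; simp at hm) (by omega)
  rw [h1, mul_one] at h2
  rw [← h2, jacobiSym.mod_right' b hn, jacobiSym.mod_right' b (hm.mul hodd)]
  congr 1
  change n ≡ m * (4 * b - 1) [MOD 4 * b]
  have hx : n + m ≡ 0 [MOD 4 * b] := by
    have : n % (4 * b) + m ≡ n + m [MOD 4 * b] := (Nat.mod_modEq n (4 * b)).add_right m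
    refine this.symm.trans ?_
    rw [h]; simp [Nat.ModEq]
  apply Nat.ModEq.add_right_cancel' m
  refine hx.trans ?_
  rw [show m * (4 * b - 1) + m = (4 * b) * m by
    obtain ⟨t, ht⟩ : ∃ t, 4 * b = t + 1 := ⟨4 * b - 1, by omega⟩
    rw [ht]; simp; ring]
  simp [Nat.ModEq]

lemma J_neg (a : ℤ) (n : ℕ) (hn : Odd n) : ((J(-a | n) : ℤ) : ℂ) * EE n = J(a | n) * conj (EE n) := by
  rw [jacobiSym.neg _ hn, EE]
  rcases (by have := Nat.odd_iff.1 hn; omega : n % 4 = 1 ∨ n % 4 = 3) with h | h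
  · rw [ZMod.χ₄_nat_one_mod_four h]; simp [h]
  · rw [ZMod.χ₄_nat_three_mod_four h]; simp [h]

lemma main_odd : ∀ (n : ℕ), Odd n → ∀ a : ℤ, a.gcd n = 1 → GG (2 * a) n = J(a | n) * EE n := by
  intro n
  induction n using Nat.strong_induction_on with
  | _ n ih =>
  intro hn a ha
  have hn2 := Nat.odd_iff.1 hn
  rcases Nat.lt_or_ge n 2 with h1 | h1
  · obtain rfl : n = 1 := by omega
    simp [GG_one, EE]
  have pos : ∀ b : ℕ, 0 < b → 2 * b < n → b.Coprime n → GG (2 * b) n = J(b | n) * EE n := by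
    intro b hb hbn hcop
    have hdm := Nat.div_add_mod n (4 * b)
    have hlt := Nat.mod_lt n (by omega : 4 * b > 0)
    have hpar : n % (4 * b) % 4 = n % 4 := Nat.mod_mod_of_dvd n (dvd_mul_right 4 b)
    set m := n % (4 * b) with hm
    have hmo : Odd m := by rw [Nat.odd_iff]; omega
    have hcm : b.Coprime m := by
      have h := hcop
      rw [← hdm, show 4 * b * (n / (4 * b)) + m = m + b * (4 * (n / (4 * b))) by ring] at h
      simpa using h
    have sw : GG (2 * b) n = zz * GG (-n) (2 * b) := by
      have := GG_swap (2 * b) n (by omega) (by omega) ((even_two_mul b).mul_right n)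
      push_cast at this
      exact this
    rcases Nat.lt_or_ge m (2 * b) with hmb | hmb
    · have sw' := GG_swap (2 * b) m (by omega) (by rcases hmo with ⟨t, ht⟩; omega) ((even_two_mul b).mul_right m)
      push_cast at sw'
      have hp := GG_per (-m) (-(n / (4 * b) : ℕ)) (2 * b)
      rw [show (-(m : ℤ) + 2 * ((2 * b : ℕ) : ℤ) * (-((n / (4 * b) : ℕ) : ℤ))) = -(n : ℤ) by
        conv_rhs => rw [← hdm]
        push_cast; ring] at hp
      rw [sw, hp, ← sw', ih m (by omega) hmo b (by simpa using hcm), jacobiSym.mod_right' b hn, ← hm]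
      simp only [EE, hpar]
    · obtain ⟨m', hm'⟩ : ∃ m', m + m' = 4 * b := ⟨4 * b - m, by omega⟩
      have hmo' : Odd m' := by rw [Nat.odd_iff] at *; omega
      have hm2 := Nat.odd_iff.1 hmo
      have hm2' := Nat.odd_iff.1 hmo'
      have hcm' : b.Coprime m' := by
        have h : b.Coprime (m + m' - m) := by
          rw [hm']
          have : b.Coprime ((m : ℤ).natAbs) := by simpa using hcm
          rw [← Nat.isCoprime_iff_coprime] at hcm ⊢
          rw [Nat.cast_sub (by omega)]
          push_cast
          have := (IsCoprime.add_mul_left_right hcm.neg_right 4)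
          rwa [show (-(m : ℤ) + b * 4) = 4 * b - m by ring] at this
        simpa using h
      have sw' := GG_swap (2 * b) m' (by omega) (by omega) ((even_two_mul b).mul_right m')
      push_cast at sw'
      have hp := GG_per m' (-((n / (4 * b) : ℕ) + 1)) (2 * b)
      rw [show ((m' : ℤ) + 2 * ((2 * b : ℕ) : ℤ) * (-(((n / (4 * b) : ℕ) : ℤ) + 1))) = -(n : ℤ) by
        conv_rhs => rw [← hdm]
        have : (m : ℤ) + m' = 4 * b := by exact_mod_cast hm'
        push_cast; linarith] at hp
      have hc := GG_conj (-m') (2 * b)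
      rw [neg_neg] at hc
      have hi := ih m' (by omega) hmo' b (by simpa using hcm')
      have hJ := J_neg_eq b n m' hb hn hmo' hm'
      rw [sw, hp, hc, hJ]
      rw [sw'] at hi
      have hi2 : GG (-m') (2 * b) = conj zz * (J(b | m') * EE m') := by
        rw [← hi, ← mul_assoc, mul_comm (conj zz), zz_mul_conj, one_mul]
      rw [hi2]
      simp only [map_mul, conj_conj]
      rw [← mul_assoc, zz_sq]
      have hE : EE n = -I * conj (EE m') := by
        simp only [EE]
        rcases (by omega : n % 4 = 1 ∨ n % 4 = 3) with h | h
        · rw [if_pos h, if_neg (by omega)]; simp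
        · rw [if_neg (by omega), if_pos (by omega)]; simp
      rw [hE]
      simp
      ring
  obtain ⟨b, hb⟩ : ∃ b, b = a.bmod n := ⟨_, rfl⟩
  have hmod : a ≡ b [ZMOD n] := by rw [hb]; exact (Int.bmod_emod).symm
  obtain ⟨k, hk⟩ := hmod.symm.dvd
  have hab : a = b + n * k := by linarith
  have hlb : -(n : ℤ) ≤ 2 * b := by have := Int.le_bmod (x := a) (m := n) (by omega); omega
  have hub : 2 * b < n := by have := Int.bmod_lt (x := a) (m := n) (by omega); omega
  have hJ : J(a | n) = J(b | n) := jacobiSym.mod_left' hmod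
  have hG : GG (2 * a) n = GG (2 * b) n := by
    rw [hab, ← GG_per (2 * b) k n]; congr 1; ring
  have hg : b.gcd n = 1 := by
    rw [hab] at ha; simpa using ha
  rw [hG, hJ]
  rcases lt_trichotomy b 0 with h | h | h
  · obtain ⟨t, ht⟩ : ∃ t : ℕ, b = -t := ⟨b.natAbs, by omega⟩
    subst ht
    rw [J_neg _ _ hn]
    have := pos t (by omega) (by omega) (by simpa using hg)
    rw [show (2 * -(t : ℤ)) = -(2 * t) by ring, GG_conj, this, map_mul]
    simp
  · subst h; simp at hg; omega
  · obtain ⟨t, ht⟩ : ∃ t : ℕ, b = t := ⟨b.natAbs, by omega⟩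
    subst ht
    exact pos t (by omega) (by omega) (by simpa using hg)

lemma gaussG_pos (d : ℤ) (c : ℕ) : gaussG d c = GG d c := by
  simp [gaussG, GG, SS]

lemma gaussG_neg (d : ℤ) (c : ℤ) : gaussG (-d) (-c) = gaussG d c := by
  simp only [gaussG, Int.natAbs_neg]
  congr 1
  refine Finset.sum_congr rfl fun r _ => ?_
  congr 1
  push_cast
  rw [div_neg, ← neg_div]
  congr 1
  ring

lemma even_case (c : ℕ) (d : ℕ) (hc : 0 < c) (hd : Odd d) (hcop : c.Coprime d) :
    GG d (2 * c) = J(c | d) * conj (EE d) * zz := by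
  have hd2 := Nat.odd_iff.1 hd
  rw [GG_swap d (2 * c) (by omega) (by omega) ((even_two_mul c).mul_left d), GG_conj]
  push_cast
  rw [main_odd d hd c (by simpa using hcop), map_mul]
  simp
  ring

lemma even_all (c d : ℤ) (hc : 0 < c) (hd : d ≠ 0) (hd2 : d % 2 = 1) (hcop : c.gcd d = 1) :
    (d.natAbs % 4 = 1 →
        gaussG d (2 * c) = (jacobiSym c d.natAbs : ℂ) *
          Complex.exp (-(Complex.I * (Real.pi : ℂ) / 4) * (Int.sign (2 * c * d) : ℂ))) ∧
      (d.natAbs % 4 = 3 →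
        gaussG d (2 * c) = Complex.I * (Int.sign d : ℂ) * (jacobiSym c d.natAbs : ℂ) *
          Complex.exp (-(Complex.I * (Real.pi : ℂ) / 4) * (Int.sign (2 * c * d) : ℂ))) := by
  obtain ⟨c, rfl⟩ := Int.eq_ofNat_of_zero_le hc.le
  have hc' : 0 < c := by exact_mod_cast hc
  have h2c : (2 * (c : ℤ)) = ((2 * c : ℕ) : ℤ) := by push_cast; ring
  have hs : Int.sign (2 * c * d) = Int.sign d := by
    rw [Int.sign_mul, Int.sign_eq_one_of_pos (by omega), one_mul]
  have h := even_case c d.natAbs hc' (by rw [Nat.odd_iff]; omega)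
    (by simpa [Int.gcd] using hcop)
  rw [hs, h2c, gaussG_pos]
  rcases lt_or_gt_of_ne hd with hd0 | hd0
  · have e : d = -(d.natAbs : ℤ) := by omega
    have h' : GG d (2 * c) = J(c | d.natAbs) * EE d.natAbs * conj zz := by
      conv_lhs => rw [e, GG_conj, h]
      simp
    rw [h', Int.sign_eq_neg_one_of_neg hd0, zz_conj]
    constructor <;> intro h4 <;> simp [EE, h4]
    ring
  · have e : d = (d.natAbs : ℤ) := by omega
    have h' : GG d (2 * c) = J(c | d.natAbs) * conj (EE d.natAbs) * zz := by
      conv_lhs => rw [e, h]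
    rw [h', Int.sign_eq_one_of_pos hd0, zz]
    constructor <;> intro h4 <;> simp [EE, h4]
    ring

end GS

theorem statement9 (c d : ℤ) (hc : c ≠ 0) (hd : d ≠ 0) (hcop : IsCoprime c d)
    (heven : Even (c * d)) :
    (∀ c' : ℤ, c = 2 * c' →
      (d.natAbs % 4 = 1 →
        gaussG d c = (jacobiSym c' d.natAbs : ℂ) *
          Complex.exp (-(Complex.I * (Real.pi : ℂ) / 4) * (Int.sign (c * d) : ℂ))) ∧
      (d.natAbs % 4 = 3 →
        gaussG d c = Complex.I * (Int.sign d : ℂ) * (jacobiSym c' d.natAbs : ℂ) *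
          Complex.exp (-(Complex.I * (Real.pi : ℂ) / 4) * (Int.sign (c * d) : ℂ)))) ∧
    (∀ d' : ℤ, d = 2 * d' →
      (c.natAbs % 4 = 1 → gaussG d c = (jacobiSym d' c.natAbs : ℂ)) ∧
      (c.natAbs % 4 = 3 →
        gaussG d c = -Complex.I * (Int.sign c : ℂ) * (jacobiSym d' c.natAbs : ℂ))) := by
  constructor
  · rintro c' rfl
    have hg : c'.gcd d = 1 := by
      rw [← Int.isCoprime_iff_gcd_eq_one]
      exact hcop.of_mul_left_right
    have hd2 : d % 2 = 1 := by
      have : IsCoprime (2 : ℤ) d := hcop.of_mul_left_left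
      rw [Int.isCoprime_iff_gcd_eq_one] at this
      by_contra hne
      have h2 : (2 : ℤ) ∣ d := by omega
      have h3 := Int.dvd_coe_gcd (dvd_refl (2 : ℤ)) h2
      rw [this] at h3
      norm_num at h3
    have hc' : c' ≠ 0 := by rintro rfl; simp at hc
    rcases lt_or_gt_of_ne hc' with h | h
    · have hodd : Odd d.natAbs := by rw [Nat.odd_iff]; omega
      have := GS.even_all (-c') (-d) (by omega) (by omega) (by omega) (by simpa using hg)
      rw [show (2 * -c') = -(2 * c') by ring, GS.gaussG_neg, neg_mul_neg, Int.natAbs_neg,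
        Int.sign_neg, jacobiSym.neg _ hodd] at this
      constructor <;> intro h4
      · rw [this.1 h4, ZMod.χ₄_nat_one_mod_four h4]; simp
      · rw [this.2 h4, ZMod.χ₄_nat_three_mod_four h4]; simp
    · exact GS.even_all c' d h hd hd2 hg
  · rintro d' rfl
    have hg : c.gcd d' = 1 := by
      rw [← Int.isCoprime_iff_gcd_eq_one]
      exact hcop.of_mul_right_right
    have hg' : d'.gcd c.natAbs = 1 := by
      rw [Int.gcd_comm]; simp only [Int.gcd, Int.natAbs_natCast] at hg ⊢; exact hg
    have key : Odd c.natAbs → (0 < c → gaussG (2 * d') c = jacobiSym d' c.natAbs * GS.EE c.natAbs) ∧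
        (c < 0 → gaussG (2 * d') c = jacobiSym d' c.natAbs * (starRingEnd ℂ) (GS.EE c.natAbs)) := by
      intro ho
      constructor <;> intro h
      · conv_lhs => rw [show c = (c.natAbs : ℤ) by omega, GS.gaussG_pos]
        exact GS.main_odd _ ho d' hg'
      · rw [← GS.gaussG_neg]
        conv_lhs => rw [show -c = (c.natAbs : ℤ) by omega, GS.gaussG_pos,
          show -(2 * d') = 2 * (-d') by ring]
        rw [GS.main_odd _ ho (-d') (by simpa using hg'), GS.J_neg _ _ ho]
    constructor <;> intro h4
    · have key := key (by rw [Nat.odd_iff]; omega)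
      rcases lt_or_gt_of_ne hc with h | h
      · rw [key.2 h]; simp [GS.EE, h4]
      · rw [key.1 h]; simp [GS.EE, h4]
    · have key := key (by rw [Nat.odd_iff]; omega)
      rcases lt_or_gt_of_ne hc with h | h
      · rw [key.2 h, Int.sign_eq_neg_one_of_neg h]; simp [GS.EE, h4]; ring
      · rw [key.1 h, Int.sign_eq_one_of_pos h]; simp [GS.EE, h4]; ring
end
end
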